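/- arXiv:1405.3529 — 2 statements merged into one kernel-verified Lean document; each statement's English description precedes it below -/
import Mathlib

section
/- Let T be a linear involution without connection and let S = L(T) be its natural coding. For every nonempty word w ∈ S, the set R_S(w) of first right return words to w is a basis of the even group of T (the subgroup of F_A consisting of all even words). -/
open Set

namespace LinInv

/-- A letter of the extended alphabet `A ∪ A⁻¹`, encoded as a pair of a letter
of `A` and a sign. -/
abbrev Letter (A : Type*) := A × Bool

/-- The formal inverse of a letter. -/
def Letter.inv {A : Type*} (c : Letter A) : Letter A := (c.1, !c.2)

/-- The inverse of a word over `A ∪ A⁻¹`. -/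
def wordInv {A : Type*} (u : List (Letter A)) : List (Letter A) :=
  (u.map Letter.inv).reverse

/-- The involution `σ₂` exchanging the two components of `Î = I × {0,1}`. -/
def s2 (z : ℝ × Bool) : ℝ × Bool := (z.1, !z.2)

/-- A linear involution on the alphabet `A`: the open interval `I = ]lo,hi[`,
for each `c ∈ A ∪ A⁻¹` an open subinterval `I_c = ]endLo c, endHi c[ × {comp c}`
of one of the two components of `Î = I × {0,1}`, the finite set `Sig` of division
points, and the first involution `σ₁`, subject to the defining conditions. -/
structure LinearInvolution (A : Type*) [Fintype A] where
  lo : ℝ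
  hi : ℝ
  lo_lt_hi : lo < hi
  endLo : Letter A → ℝ
  endHi : Letter A → ℝ
  end_lt : ∀ c, endLo c < endHi c
  comp : Letter A → Bool
  sub_lo : ∀ c, lo ≤ endLo c
  sub_hi : ∀ c, endHi c ≤ hi
  /-- the length data satisfy `λ_a = λ_{a⁻¹}` -/
  len_inv : ∀ c, endHi c - endLo c = endHi (Letter.inv c) - endLo (Letter.inv c)
  /-- the set of division points -/
  Sig : Set (ℝ × Bool)
  Sig_sub : Sig ⊆ Ioo lo hi ×ˢ (univ : Set Bool)
  /-- there are `2k-2` division points -/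
  Sig_card : Sig.ncard = 2 * Fintype.card A - 2
  /-- the intervals `I_c` are pairwise disjoint -/
  disj : ∀ c d : Letter A, c ≠ d →
    Disjoint (Ioo (endLo c) (endHi c) ×ˢ ({comp c} : Set Bool))
      (Ioo (endLo d) (endHi d) ×ˢ ({comp d} : Set Bool))
  Sig_disj : ∀ c : Letter A,
    Disjoint Sig (Ioo (endLo c) (endHi c) ×ˢ ({comp c} : Set Bool))
  /-- the intervals `I_c` partition `Î` minus the division points -/
  cover : Ioo lo hi ×ˢ (univ : Set Bool) =
    (⋃ c : Letter A, Ioo (endLo c) (endHi c) ×ˢ ({comp c} : Set Bool)) ∪ Sig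
  /-- the first involution `σ₁` (as a total map; only its values on `Î ∖ Σ` matter) -/
  s1 : ℝ × Bool → ℝ × Bool
  s1_invol : ∀ z ∈ (Ioo lo hi ×ˢ (univ : Set Bool)) \ Sig, s1 (s1 z) = z
  /-- on each `I_c`, `σ₁` is either a translation or a symmetry -/
  s1_iso : ∀ c : Letter A,
    (∃ α : ℝ, ∀ z ∈ Ioo (endLo c) (endHi c) ×ˢ ({comp c} : Set Bool),
        s1 z = (z.1 + α, comp (Letter.inv c))) ∨
    (∃ α : ℝ, ∀ z ∈ Ioo (endLo c) (endHi c) ×ˢ ({comp c} : Set Bool),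
        s1 z = (-z.1 + α, comp (Letter.inv c)))
  /-- `σ₁` maps `I_c` onto `I_{c⁻¹}` -/
  s1_image : ∀ c : Letter A,
    s1 '' (Ioo (endLo c) (endHi c) ×ˢ ({comp c} : Set Bool)) =
      Ioo (endLo (Letter.inv c)) (endHi (Letter.inv c)) ×ˢ
        ({comp (Letter.inv c)} : Set Bool)

namespace LinearInvolution

variable {A : Type*} [Fintype A] (L : LinearInvolution A)

/-- The domain `Î = I × {0,1}`. -/
def Ihat : Set (ℝ × Bool) := Ioo L.lo L.hi ×ˢ (univ : Set Bool)

/-- The interval `I_c` associated with the letter `c ∈ A ∪ A⁻¹`. -/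
def Ia (c : Letter A) : Set (ℝ × Bool) :=
  Ioo (L.endLo c) (L.endHi c) ×ˢ ({L.comp c} : Set Bool)

/-- The linear involution `T = σ₂ ∘ σ₁`. -/
def T (z : ℝ × Bool) : ℝ × Bool := s2 (L.s1 z)

/-- `O = ⋃_{n ≥ 0} T⁻ⁿ(Σ)`, the negative orbit of the singular points. -/
def O : Set (ℝ × Bool) := ⋃ n : ℕ, (L.T)^[n] ⁻¹' L.Sig

/-- `Ô = O ∪ σ₂(O)`. -/
def Ohat : Set (ℝ × Bool) := L.O ∪ s2 '' L.O

/-- `T` has a connection if some singularity `x` of `T⁻¹` reaches a singularity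
`y` of `T` in `n ≥ 0` steps. -/
def HasConnection : Prop := ∃ x ∈ s2 '' L.Sig, ∃ n : ℕ, (L.T)^[n] x ∈ L.Sig

/-- `T` is nonorientable if some `I_c` and `I_{c⁻¹}` lie in the same component. -/
def Nonorientable : Prop := ∃ c : Letter A, L.comp c = L.comp (Letter.inv c)

/-- `T` is orientable if it is not nonorientable. -/
def Orientable : Prop := ¬ L.Nonorientable

/-- `u` occurs in the natural coding of the orbit of `z` at position `m`. -/
def IsCodingFrom (z : ℝ × Bool) (m : ℕ) (u : List (Letter A)) : Prop :=
  ∀ i : Fin u.length, (L.T)^[m + i.1] z ∈ L.Ia (u.get i)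

/-- The natural coding `L(T)`: the set of factors of the infinite natural
codings `Σ_T(z)` for `z ∈ Î ∖ Ô`. -/
def lang : Set (List (Letter A)) :=
  {u | ∃ z ∈ L.Ihat \ L.Ohat, ∃ m : ℕ, L.IsCodingFrom z m u}

/-- The interval `I_w = I_{a₀} ∩ T⁻¹(I_{a₁}) ∩ ⋯ ∩ T^{-m+1}(I_{a_{m-1}})`
associated with a word `w = a₀a₁⋯a_{m-1}`; by convention `I_ε = Î`. -/
def Iw (u : List (Letter A)) : Set (ℝ × Bool) :=
  L.Ihat ∩ ⋂ i : Fin u.length, (L.T)^[i.1] ⁻¹' L.Ia (u.get i)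

/-- The return time `ρ_X(x) = inf {n ≥ 1 ∣ Tⁿ(x) ∈ X}`, with value `∞` if the
orbit of `x` never returns to `X`. -/
noncomputable def retTime (X : Set (ℝ × Bool)) (x : ℝ × Bool) : ℕ∞ :=
  sInf {n : ℕ∞ | ∃ m : ℕ, n = (m : ℕ∞) ∧ 1 ≤ m ∧ (L.T)^[m] x ∈ X}

/-- A word is even if it has an even number of odd letters (a letter `a` is odd
when `I_a` and `I_{a⁻¹}` lie in the same component). -/
def EvenWord (u : List (Letter A)) : Prop :=
  Even (u.countP fun c => L.comp (c.1, true) == L.comp (c.1, false))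

/-- The morphism `F_A → ℤ/2ℤ` sending each odd letter to `1` and each even
letter to `0`. -/
noncomputable def evenHom : FreeGroup A →* Multiplicative (ZMod 2) :=
  FreeGroup.lift fun a =>
    Multiplicative.ofAdd (if L.comp (a, true) = L.comp (a, false) then (1 : ZMod 2) else 0)

/-- The even group: the subgroup of `F_A` formed by the even elements. -/
noncomputable def evenGroup : Subgroup (FreeGroup A) := (L.evenHom).ker

/-- The admissibility condition at an endpoint `x` of an interval `J`:
either `x = Tⁿ(z)` for a singularity `z` of `T⁻¹` with `T^k(z) ∉ J` for
`0 ≤ k ≤ n`, or `Tⁿ(x) = z` for a singularity `z` of `T` with `T^k(x) ∉ J`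
for `0 ≤ k ≤ n`. -/
def AdmissibleEndpoint (J : Set (ℝ × Bool)) (x : ℝ × Bool) : Prop :=
  (∃ z ∈ s2 '' L.Sig, ∃ n : ℕ, (L.T)^[n] z = x ∧ ∀ k ≤ n, (L.T)^[k] z ∉ J) ∨
  (∃ z ∈ L.Sig, ∃ n : ℕ, (L.T)^[n] x = z ∧ ∀ k ≤ n, (L.T)^[k] x ∉ J)

/-- The open interval `]u,v[ × {δ}` is admissible with respect to `T`. -/
def AdmissibleInterval (u v : ℝ) (δ : Bool) : Prop :=
  u < v ∧ L.AdmissibleEndpoint (Ioo u v ×ˢ ({δ} : Set Bool)) (u, δ) ∧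
    L.AdmissibleEndpoint (Ioo u v ×ˢ ({δ} : Set Bool)) (v, δ)

end LinearInvolution

/-- A set of words is factorial if it contains the factors of its elements. -/
def FactorialSet {α : Type*} (S : Set (List α)) : Prop :=
  ∀ u ∈ S, ∀ v : List α, v <:+: u → v ∈ S

/-- A word over `A ∪ A⁻¹` is reduced if it has no factor `c c⁻¹`. -/
def Reduced {A : Type*} (u : List (Letter A)) : Prop :=
  u.Chain' fun c d => d ≠ Letter.inv c

/-- A laminary set on `A`: a symmetric factorial set of reduced words on
`A ∪ A⁻¹`. -/
def Laminary {A : Type*} (S : Set (List (Letter A))) : Prop :=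
  FactorialSet S ∧ (∀ u ∈ S, wordInv u ∈ S) ∧ ∀ u ∈ S, Reduced u

/-- A laminary set is orientable if it splits as `S₊ ∪ S₋` with `S₊, S₋`
factorial, `S₊ ∩ S₋ = {ε}`, and `x ∈ S₋ ↔ x⁻¹ ∈ S₊`. -/
def OrientableSet {A : Type*} (S : Set (List (Letter A))) : Prop :=
  ∃ Sp Sm : Set (List (Letter A)), FactorialSet Sp ∧ FactorialSet Sm ∧
    S = Sp ∪ Sm ∧ Sp ∩ Sm = {([] : List (Letter A))} ∧
    ∀ x ∈ S, (x ∈ Sm ↔ wordInv x ∈ Sp)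

/-- A set of words is uniformly recurrent if it is right extendable and every
`u ∈ S` occurs in every long enough word of `S`. -/
def UniformlyRecurrent {α : Type*} (S : Set (List α)) : Prop :=
  (∀ u ∈ S, ∃ c : α, u ++ [c] ∈ S) ∧
  ∀ u ∈ S, ∃ n : ℕ, 1 ≤ n ∧ ∀ w ∈ S, w.length = n → u <:+: w

/-- A set of words over `A ∪ A⁻¹` is uniformly semi-recurrent if it is right
extendable and for every `u ∈ S`, every long enough word of `S` contains `u` or
`u⁻¹` as a factor. -/
def UniformlySemiRecurrent {A : Type*} (S : Set (List (Letter A))) : Prop :=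
  (∀ u ∈ S, ∃ c : Letter A, u ++ [c] ∈ S) ∧
  ∀ u ∈ S, ∃ n : ℕ, 1 ≤ n ∧ ∀ w ∈ S, w.length = n → (u <:+: w ∨ wordInv u <:+: w)

/-- A laminary set is semi-recurrent if for all `u, w ∈ S` there is `v ∈ S`
with `uvw ∈ S` or `uvw⁻¹ ∈ S`. -/
def SemiRecurrent {A : Type*} (S : Set (List (Letter A))) : Prop :=
  ∀ u ∈ S, ∀ w ∈ S, ∃ v ∈ S, u ++ v ++ w ∈ S ∨ u ++ v ++ wordInv w ∈ S

/-- A complete return word to `X ⊆ S`: a word of `S` with a proper prefix in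
`X` and a proper suffix in `X`. -/
def CompleteReturnWord {α : Type*} (S X : Set (List α)) (u : List α) : Prop :=
  u ∈ S ∧ (∃ p ∈ X, p <+: u ∧ p ≠ u) ∧ (∃ s ∈ X, s <:+ u ∧ s ≠ u)

/-- A complete first return word to `X`: a complete return word to `X` with no
internal factor in `X`. -/
def CompleteFirstReturnWord {α : Type*} (S X : Set (List α)) (u : List α) : Prop :=
  CompleteReturnWord S X u ∧
    ¬ ∃ p v s : List α, u = p ++ v ++ s ∧ v ∈ X ∧ p ≠ [] ∧ s ≠ []

/-- `CR S w`: the set of complete first return words to `{w, w⁻¹}` in `S`. -/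
def CR {A : Type*} (S : Set (List (Letter A))) (w : List (Letter A)) :
    Set (List (Letter A)) :=
  {u | CompleteFirstReturnWord S {w, wordInv w} u}

open Classical in
/-- The operation `N` on complete return words to `{w, w⁻¹}`: erase the prefix
`w` if present, and erase the suffix `w⁻¹` if present. -/
noncomputable def NN {A : Type*} (w u : List (Letter A)) : List (Letter A) :=
  let u' := if w <+: u then u.drop w.length else u
  if wordInv w <:+ u' then u'.take (u'.length - w.length) else u'

/-- `MR S w`: the set of mixed first return words to `w` in `S`. -/
noncomputable def MR {A : Type*} (S : Set (List (Letter A))) (w : List (Letter A)) :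
    Set (List (Letter A)) :=
  NN w '' CR S w

/-- `RightReturn S w`: the set of first right return words to `w` in `S`,
i.e. the words `u` such that `wu` is a complete first return word to `{w}`. -/
def RightReturn {α : Type*} (S : Set (List α)) (w : List α) : Set (List α) :=
  {u | CompleteFirstReturnWord S {w} (w ++ u)}

/-- `X` is a basis (free generating set) of the subgroup `H`: the canonical map
`FreeGroup X → G` is injective with range `H`. -/
def IsBasisOf {G : Type*} [Group G] (X : Set G) (H : Subgroup G) : Prop :=
  Function.Injective (FreeGroup.lift (fun x : X => (x : G))) ∧
    (FreeGroup.lift (fun x : X => (x : G)) : FreeGroup X →* G).range = H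

/-- `Y` is a symmetric basis of `H` if `Y = X ∪ X⁻¹` for some basis `X` of `H`. -/
def IsSymmetricBasisOf {G : Type*} [Group G] (Y : Set G) (H : Subgroup G) : Prop :=
  ∃ X : Set G, IsBasisOf X H ∧ Y = X ∪ X⁻¹

/-- The prime words in `S` with respect to a subgroup `G` of `F_A`: the
nonempty words of `G ∩ S` without a proper nonempty prefix in `G ∩ S`. -/
def PrimeWords {A : Type*} (S : Set (List (Letter A))) (G : Subgroup (FreeGroup A)) :
    Set (List (Letter A)) :=
  {u | u ∈ S ∧ u ≠ [] ∧ FreeGroup.mk u ∈ G ∧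
    ∀ p : List (Letter A), p <+: u → p ≠ [] → p ≠ u → ¬(p ∈ S ∧ FreeGroup.mk p ∈ G)}

theorem exists_perm_lift_ne_one {X : Type*} (x : FreeGroup X) (hx : x ≠ 1) :
    ∃ F : Set (FreeGroup X), F.Finite ∧ ∃ f : X → Equiv.Perm F, FreeGroup.lift f x ≠ 1 := by
  classical
  set F : Set (FreeGroup X) := FreeGroup.mk '' {s | s <:+ x.toWord} with hF
  have hfin : F.Finite := by
    refine Set.Finite.image _ ((List.finite_toSet x.toWord.tails).subset ?_)
    intro s hs
    simpa using hs
  have hext : ∀ a : X, ∃ σ : Equiv.Perm F, ∀ g h : F,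
      (h : FreeGroup X) = FreeGroup.of a * g → σ g = h := by
    intro a
    have := hfin.fintype
    let e : {g : F // FreeGroup.of a * (g : FreeGroup X) ∈ F} ≃
        {h : F // (FreeGroup.of a)⁻¹ * (h : FreeGroup X) ∈ F} :=
      { toFun := fun g => ⟨⟨_, g.2⟩, by simp⟩
        invFun := fun h => ⟨⟨_, h.2⟩, by simp⟩
        left_inv := fun g => by ext; simp
        right_inv := fun h => by ext; simp }
    refine ⟨e.extendSubtype, fun g h hgh => ?_⟩
    have hg : FreeGroup.of a * (g : FreeGroup X) ∈ F := hgh ▸ h.2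
    rw [Equiv.extendSubtype_apply_of_mem e g hg]
    exact Subtype.ext hgh.symm
  choose σ hσ using hext
  have h1 : (1 : FreeGroup X) ∈ F := ⟨[], List.nil_suffix, rfl⟩
  refine ⟨F, hfin, σ, fun hcon => ?_⟩
  have hmem : ∀ s : List (X × Bool), s <:+ x.toWord → FreeGroup.mk s ∈ F := fun s hs => ⟨s, hs, rfl⟩
  have key : ∀ s : List (X × Bool), s <:+ x.toWord →
      (FreeGroup.lift σ (FreeGroup.mk s) ⟨1, h1⟩ : FreeGroup X) = FreeGroup.mk s := by
    intro s
    induction s with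
    | nil => intro hs; simp [← FreeGroup.one_eq_mk]
    | cons c s ih =>
      intro hs
      have hs' : s <:+ x.toWord := (List.suffix_cons c s).trans hs
      have e1 : FreeGroup.mk (c :: s) = FreeGroup.mk [c] * FreeGroup.mk s := by
        rw [FreeGroup.mul_mk]; rfl
      have e2 : FreeGroup.lift σ (FreeGroup.mk (c :: s)) ⟨1, h1⟩ =
          FreeGroup.lift σ (FreeGroup.mk [c]) ⟨FreeGroup.mk s, hmem s hs'⟩ := by
        rw [e1, map_mul, Equiv.Perm.mul_apply]
        exact congrArg _ (Subtype.ext (ih hs'))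
      suffices h : FreeGroup.lift σ (FreeGroup.mk [c]) ⟨FreeGroup.mk s, hmem s hs'⟩ =
          ⟨FreeGroup.mk (c :: s), hmem _ hs⟩ by
        rw [e2, h]
      obtain ⟨a, b⟩ := c
      cases b with
      | true =>
        have : FreeGroup.lift σ (FreeGroup.mk [(a, true)]) = σ a := by simp
        rw [this]
        exact hσ _ _ _ e1
      | false =>
        have : FreeGroup.lift σ (FreeGroup.mk [(a, false)]) = (σ a)⁻¹ := by simp
        rw [this, Equiv.Perm.inv_eq_iff_eq, eq_comm]
        apply hσ
        have h2 : (FreeGroup.mk [(a, false)] : FreeGroup X) = (FreeGroup.of a)⁻¹ := rfl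
        change _ = FreeGroup.of a * FreeGroup.mk ((a, false) :: s)
        rw [e1, h2, mul_inv_cancel_left]
  have := key x.toWord List.suffix_rfl
  rw [FreeGroup.mk_toWord, hcon] at this
  exact hx this.symm

@[simp] theorem Letter.inv_inv {A : Type*} (c : Letter A) : Letter.inv (Letter.inv c) = c := by
  simp [Letter.inv]

theorem mk_letter_inv {A : Type*} (c : Letter A) :
    (FreeGroup.mk [Letter.inv c] : FreeGroup A) = (FreeGroup.mk [c])⁻¹ := by
  simp [FreeGroup.inv_mk, FreeGroup.invRev, Letter.inv]

theorem mk_cons {A : Type*} (c : Letter A) (u : List (Letter A)) :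
    (FreeGroup.mk (c :: u) : FreeGroup A) = FreeGroup.mk [c] * FreeGroup.mk u := by
  rw [FreeGroup.mul_mk]; rfl

namespace LinearInvolution

universe v
variable {A : Type v} [Fintype A] (L : LinearInvolution A)

/-- `L.Path δ u δ'`: an orbit starting in the component `δ` and coded by `u` ends in the
component `δ'`. -/
def Path : Bool → List (Letter A) → Bool → Prop
  | δ, [], δ' => δ = δ'
  | δ, c :: u, δ' => L.comp c = δ ∧ Path (!L.comp (Letter.inv c)) u δ'

theorem comp_inv_eq_iff (c : Letter A) :
    L.comp c = L.comp (Letter.inv c) ↔ L.comp (c.1, true) = L.comp (c.1, false) := by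
  obtain ⟨a, b⟩ := c
  cases b <;> simp [Letter.inv, eq_comm]

theorem evenHom_letter (c : Letter A) : L.evenHom (FreeGroup.mk [c]) =
    Multiplicative.ofAdd (if L.comp c = L.comp (Letter.inv c) then (1 : ZMod 2) else 0) := by
  rw [if_congr (L.comp_inv_eq_iff c) rfl rfl]
  obtain ⟨a, b⟩ := c
  cases b with
  | true => simp [evenHom]
  | false =>
    simp only [evenHom, FreeGroup.lift_mk, List.map_cons, List.map_nil, List.prod_cons,
      List.prod_nil, mul_one, cond_false]
    split_ifs <;> decide

theorem evenHom_of_path {u : List (Letter A)} : ∀ {δ δ' : Bool}, L.Path δ u δ' →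
    L.evenHom (FreeGroup.mk u) = Multiplicative.ofAdd (if δ = δ' then (0 : ZMod 2) else 1) := by
  induction u with
  | nil =>
    intro δ δ' h
    have : δ = δ' := h
    simp [this, ← FreeGroup.one_eq_mk]
  | cons c u ih =>
    rintro δ δ' ⟨rfl, h⟩
    rw [mk_cons, map_mul, ih h, evenHom_letter, ← ofAdd_add]
    congr 1
    cases L.comp c <;> cases L.comp (Letter.inv c) <;> cases δ' <;> decide

/-- The action of a letter on `{0,1} × G` through the transition values `φ`. -/
def letterMap {G : Type*} [Group G] (φ : Letter A → G) (c : Letter A) (x : Bool × G) : Bool × G :=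
  if L.comp c = x.1 then (!L.comp (Letter.inv c), x.2 * φ c)
  else (L.comp (Letter.inv c), x.2 * (φ (Letter.inv c))⁻¹)

theorem letterMap_inv {G : Type*} [Group G] (φ : Letter A → G) (c : Letter A) (x : Bool × G) :
    L.letterMap φ (Letter.inv c) (L.letterMap φ c x) = x := by
  obtain ⟨δ, g⟩ := x
  unfold letterMap
  by_cases h : L.comp c = δ
  · simp [h]
  · simp only [h, if_false, if_true, Letter.inv_inv, inv_mul_cancel_right, Prod.mk.injEq, and_true]
    cases hc : L.comp c <;> cases δ <;> simp_all

/-- The permutation of `{0,1} × G` given by a letter. -/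
def letterPerm {G : Type*} [Group G] (φ : Letter A → G) (c : Letter A) :
    Equiv.Perm (Bool × G) where
  toFun := L.letterMap φ c
  invFun := L.letterMap φ (Letter.inv c)
  left_inv := L.letterMap_inv φ c
  right_inv x := by simpa using L.letterMap_inv φ (Letter.inv c) x

/-- The action of the free group on `{0,1} × G` (from the right, reading words from left to
right). -/
def groupAct {G : Type*} [Group G] (φ : Letter A → G) :
    FreeGroup A →* (Equiv.Perm (Bool × G))ᵐᵒᵖ :=
  FreeGroup.lift fun a => MulOpposite.op (L.letterPerm φ (a, true))

theorem groupAct_letter {G : Type*} [Group G] (φ : Letter A → G) (c : Letter A) :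
    L.groupAct φ (FreeGroup.mk [c]) = MulOpposite.op (L.letterPerm φ c) := by
  obtain ⟨a, b⟩ := c
  cases b with
  | true => simp [groupAct]
  | false =>
    simp only [groupAct, FreeGroup.lift_mk, List.map_cons, List.map_nil, List.prod_cons,
      List.prod_nil, mul_one, cond_false, ← MulOpposite.op_inv]
    rfl

theorem groupAct_path {G : Type*} [Group G] (φ : Letter A → G) {u : List (Letter A)} :
    ∀ {δ δ' : Bool} (g : G), L.Path δ u δ' →
    (L.groupAct φ (FreeGroup.mk u)).unop (δ, g) = (δ', g * (u.map φ).prod) := by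
  induction u with
  | nil =>
    intro δ δ' g h
    have : δ = δ' := h
    simp [this, ← FreeGroup.one_eq_mk]
  | cons c u ih =>
    rintro δ δ' g ⟨rfl, h⟩
    rw [mk_cons, map_mul, groupAct_letter, MulOpposite.unop_mul, Equiv.Perm.mul_apply]
    have : (MulOpposite.op (L.letterPerm φ c)).unop (L.comp c, g) =
        (!L.comp (Letter.inv c), g * φ c) := by
      simp [letterPerm, letterMap]
    rw [this, ih _ h]
    simp [mul_assoc]

theorem lift_injective_of_solvable (R : Set (List (Letter A))) (e : Bool)
    (hR : ∀ u ∈ R, L.Path e u e)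
    (hsol : ∀ (G : Type v) [Group G] [Finite G] (f : List (Letter A) → G),
      ∃ φ : Letter A → G, ∀ u ∈ R, (u.map φ).prod = f u) :
    Function.Injective (FreeGroup.lift
      (fun x : (FreeGroup.mk '' R : Set (FreeGroup A)) => (x : FreeGroup A))) := by
  classical
  rw [injective_iff_map_eq_one]
  intro x hx
  by_contra hne
  obtain ⟨F, hF, f, hf⟩ := exists_perm_lift_ne_one x hne
  have := hF.to_subtype
  obtain ⟨φ, hφ⟩ := hsol (Equiv.Perm F) fun u =>
    if h : u ∈ R then f ⟨FreeGroup.mk u, u, h, rfl⟩ else 1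
  have key : ∀ y (g : Equiv.Perm F), (L.groupAct φ (FreeGroup.lift
      (fun x : (FreeGroup.mk '' R : Set (FreeGroup A)) => (x : FreeGroup A)) y)).unop (e, g) =
      (e, g * FreeGroup.lift f y) := by
    have hof : ∀ (y : (FreeGroup.mk '' R : Set (FreeGroup A))) (g : Equiv.Perm F),
        (L.groupAct φ (y : FreeGroup A)).unop (e, g) = (e, g * f y) := by
      rintro ⟨_, u, hu, rfl⟩ g
      rw [L.groupAct_path φ g (hR u hu), hφ u hu, dif_pos hu]
    intro y
    induction y using FreeGroup.induction_on with
    | C1 => intro g; simp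
    | of y => intro g; simpa using hof y g
    | inv_of y _ =>
      intro g
      simp only [map_inv, FreeGroup.lift_apply_of, MulOpposite.unop_inv]
      rw [Equiv.Perm.inv_eq_iff_eq, hof]
      simp
    | mul y z hy hz =>
      intro g
      simp only [map_mul, MulOpposite.unop_mul, Equiv.Perm.mul_apply]
      rw [hy, hz, mul_assoc]
  have := key x 1
  rw [hx] at this
  simp only [map_one, MulOpposite.unop_one, Equiv.Perm.coe_one, id_eq, one_mul,
    Prod.mk.injEq, true_and] at this
  exact hf this.symm

theorem exists_solution (R : Set (List (Letter A))) (hfin : R.Finite) (δ e : Bool)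
    (hor : L.Nonorientable ∨ e = δ)
    (hcard : L.Nonorientable → R.ncard + 1 ≤ Fintype.card (Letter A))
    (hcard' : ¬ L.Nonorientable → R.ncard ≤ Nat.card {c : Letter A // L.comp c = δ})
    {G : Type*} [Group G] [Finite G]
    (hgauge : ∀ φ φ' : Letter A → G,
      (∀ u ∈ R, (u.map φ).prod = (u.map φ').prod) → ∃ γ : Bool → G, γ e = 1 ∧
        ∀ c, (L.comp c = δ ∨ L.Nonorientable) →
          φ' c = γ (L.comp c) * φ c * (γ (!L.comp (Letter.inv c)))⁻¹)
    (f : List (Letter A) → G) :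
    ∃ φ : Letter A → G, ∀ u ∈ R, (u.map φ).prod = f u := by
  classical
  have := hfin.to_subtype
  have hRc : Nat.card R = R.ncard := rfl
  by_cases hN : L.Nonorientable
  · obtain ⟨c₀, hc₀⟩ := id hN
    let Φ : (Letter A → G) → (R → G) × G := fun φ => (fun u => (u.1.map φ).prod, φ c₀)
    have hinj : Function.Injective Φ := by
      intro φ φ' h
      have h1 := congrArg Prod.fst h
      have h2 : φ c₀ = φ' c₀ := congrArg Prod.snd h
      obtain ⟨γ, hγe, hγ⟩ := hgauge φ φ' fun u hu => congrFun h1 ⟨u, hu⟩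
      have h3 := hγ c₀ (Or.inr hN)
      rw [← h2, ← hc₀] at h3
      have hall : ∀ b, γ b = 1 := by
        have hγ1 : γ (L.comp c₀) = 1 ∧ γ (!L.comp c₀) = 1 := by
          by_cases hb : L.comp c₀ = e
          · rw [hb, hγe] at h3
            refine ⟨by rw [hb, hγe], ?_⟩
            rw [hb]
            simpa using h3
          · have hb' : (!L.comp c₀) = e := by
              rw [Bool.not_eq_eq_eq_not, Bool.eq_not]; exact hb
            rw [hb', hγe] at h3
            refine ⟨?_, by rw [hb', hγe]⟩
            simpa using h3
        intro b
        by_cases hb : b = L.comp c₀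
        · rw [hb]; exact hγ1.1
        · have : b = !L.comp c₀ := Bool.eq_not.2 hb
          rw [this]; exact hγ1.2
      ext c
      rw [hγ c (Or.inr hN)]
      simp [hall]
    have hle : Nat.card ((R → G) × G) ≤ Nat.card (Letter A → G) := by
      rw [Nat.card_prod, Nat.card_fun, Nat.card_fun, ← pow_succ, hRc, Nat.card_eq_fintype_card (α := Letter A)]
      exact Nat.pow_le_pow_right Nat.card_pos (hcard hN)
    obtain ⟨φ, hφ⟩ := (hinj.bijective_of_nat_card_le hle).2 (fun u => f u.1, 1)
    exact ⟨φ, fun u hu => congrFun (congrArg Prod.fst hφ) ⟨u, hu⟩⟩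
  · obtain rfl : e = δ := hor.resolve_left hN
    have hflip : ∀ c, (!L.comp (Letter.inv c)) = L.comp c := by
      intro c
      by_contra h
      apply hN
      exact ⟨c, (Bool.eq_not.2 (Ne.symm h)).trans (Bool.not_not _)⟩
    let E : ({c : Letter A // L.comp c = e} → G) → Letter A → G :=
      fun φ c => if h : L.comp c = e then φ ⟨c, h⟩ else 1
    let Φ : ({c : Letter A // L.comp c = e} → G) → (R → G) :=
      fun φ u => (u.1.map (E φ)).prod
    have hinj : Function.Injective Φ := by
      intro φ φ' h
      obtain ⟨γ, hγe, hγ⟩ := hgauge (E φ) (E φ') fun u hu => congrFun h ⟨u, hu⟩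
      ext ⟨c, hc⟩
      have := hγ c (Or.inl hc)
      rw [hflip, hc, hγe] at this
      simpa [E, hc] using this.symm
    have hle : Nat.card (R → G) ≤ Nat.card ({c : Letter A // L.comp c = e} → G) := by
      rw [Nat.card_fun, Nat.card_fun, hRc]
      exact Nat.pow_le_pow_right Nat.card_pos (hcard' hN)
    obtain ⟨φ, hφ⟩ := (hinj.bijective_of_nat_card_le hle).2 (fun u => f u.1)
    exact ⟨E φ, fun u hu => congrFun hφ ⟨u, hu⟩⟩

end LinearInvolution

section

open Filter Topology

@[simp] theorem s2_s2 (z : ℝ × Bool) : s2 (s2 z) = z := by simp [s2]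

theorem continuous_s2 : Continuous s2 := by
  have h : Continuous (fun b : Bool => !b) := continuous_of_discreteTopology
  exact continuous_fst.prodMk (h.comp continuous_snd)

theorem eventually_nhds_prod_bool {x : ℝ} {δ : Bool} {p : ℝ × Bool → Prop} :
    (∀ᶠ q in 𝓝 (x, δ), p q) ↔ ∀ᶠ y in 𝓝 x, p (y, δ) := by
  rw [nhds_prod_eq, nhds_discrete Bool, prod_pure, eventually_map]

namespace LinearInvolution

variable {A : Type*} [Fintype A] (L : LinearInvolution A)

theorem isOpen_Ihat : IsOpen L.Ihat := isOpen_Ioo.prod isOpen_univ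

theorem isOpen_Ia (c : Letter A) : IsOpen (L.Ia c) := isOpen_Ioo.prod (isOpen_discrete _)

variable {L}

theorem mem_Ihat {z : ℝ × Bool} : z ∈ L.Ihat ↔ L.lo < z.1 ∧ z.1 < L.hi := by
  simp [Ihat]

theorem mem_Ia {c : Letter A} {z : ℝ × Bool} :
    z ∈ L.Ia c ↔ (L.endLo c < z.1 ∧ z.1 < L.endHi c) ∧ z.2 = L.comp c := by
  simp [Ia]

theorem s2_mem_Ihat {z : ℝ × Bool} : s2 z ∈ L.Ihat ↔ z ∈ L.Ihat := by
  simp [mem_Ihat, s2]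

theorem mem_Ihat_of_mem_Ia {c : Letter A} {z : ℝ × Bool} (h : z ∈ L.Ia c) : z ∈ L.Ihat := by
  rw [mem_Ia] at h
  rw [mem_Ihat]
  have := L.sub_lo c
  have := L.sub_hi c
  constructor <;> linarith [h.1.1, h.1.2]

theorem notMem_Sig_of_mem_Ia {c : Letter A} {z : ℝ × Bool} (h : z ∈ L.Ia c) : z ∉ L.Sig :=
  fun hz => (L.Sig_disj c).le_bot ⟨hz, h⟩

theorem exists_mem_Ia {z : ℝ × Bool} (h : z ∈ L.Ihat) (h' : z ∉ L.Sig) : ∃ c, z ∈ L.Ia c := by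
  have h1 : z ∈ (⋃ c : Letter A, L.Ia c) ∪ L.Sig := L.cover ▸ h
  simpa using h1.resolve_right h'

theorem eq_of_mem_Ia {c d : Letter A} {z : ℝ × Bool} (h : z ∈ L.Ia c) (h' : z ∈ L.Ia d) :
    c = d := by
  by_contra hne
  exact (L.disj c d hne).le_bot ⟨h, h'⟩

theorem exists_T_eq (c : Letter A) : ∃ s α : ℝ, (s = 1 ∨ s = -1) ∧
    ∀ z ∈ L.Ia c, L.T z = (s * z.1 + α, !L.comp (Letter.inv c)) := by
  rcases L.s1_iso c with ⟨α, h⟩ | ⟨α, h⟩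
  · refine ⟨1, α, Or.inl rfl, fun z hz => ?_⟩
    simp [T, h z hz, s2]
  · refine ⟨-1, α, Or.inr rfl, fun z hz => ?_⟩
    simp [T, h z hz, s2]

theorem s2_T (z : ℝ × Bool) : s2 (L.T z) = L.s1 z := by simp [T]

theorem s2_T_mem_Ia {c : Letter A} {z : ℝ × Bool} (h : z ∈ L.Ia c) :
    s2 (L.T z) ∈ L.Ia (Letter.inv c) := by
  rw [s2_T]
  have : L.s1 z ∈ L.s1 '' L.Ia c := ⟨z, h, rfl⟩
  rwa [show L.s1 '' L.Ia c = L.Ia (Letter.inv c) from L.s1_image c] at this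

theorem T_snd {c : Letter A} {z : ℝ × Bool} (h : z ∈ L.Ia c) :
    (L.T z).2 = !L.comp (Letter.inv c) := by
  obtain ⟨s, α, -, h'⟩ := L.exists_T_eq c
  rw [h' z h]

theorem T_mem_Ihat {z : ℝ × Bool} (h : z ∈ L.Ihat) (h' : z ∉ L.Sig) : L.T z ∈ L.Ihat := by
  obtain ⟨c, hc⟩ := exists_mem_Ia h h'
  rw [← s2_mem_Ihat]
  exact mem_Ihat_of_mem_Ia (s2_T_mem_Ia hc)

theorem s2_T_notMem_Sig {z : ℝ × Bool} (h : z ∈ L.Ihat) (h' : z ∉ L.Sig) :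
    s2 (L.T z) ∉ L.Sig := by
  obtain ⟨c, hc⟩ := exists_mem_Ia h h'
  exact notMem_Sig_of_mem_Ia (s2_T_mem_Ia hc)

theorem T_s2_T {z : ℝ × Bool} (h : z ∈ L.Ihat) (h' : z ∉ L.Sig) :
    L.T (s2 (L.T z)) = s2 z := by
  rw [s2_T, T, L.s1_invol z ⟨h, h'⟩]

theorem T_inj {z z' : ℝ × Bool} (h : z ∈ L.Ihat) (h' : z ∉ L.Sig) (k : z' ∈ L.Ihat)
    (k' : z' ∉ L.Sig) (e : L.T z = L.T z') : z = z' := by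
  have := T_s2_T h h'
  rw [e, T_s2_T k k'] at this
  simpa using (congrArg s2 this).symm

theorem continuousAt_T {z : ℝ × Bool} (h : z ∈ L.Ihat) (h' : z ∉ L.Sig) :
    ContinuousAt L.T z := by
  obtain ⟨c, hc⟩ := exists_mem_Ia h h'
  obtain ⟨s, α, -, hT⟩ := L.exists_T_eq c
  have h1 : ContinuousAt (fun z : ℝ × Bool => (s * z.1 + α, !L.comp (Letter.inv c))) z := by
    fun_prop
  refine h1.congr ?_
  filter_upwards [(L.isOpen_Ia c).mem_nhds hc] with q hq
  exact (hT q hq).symm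

variable (L) in
/-- The inverse branch of `T`. -/
def Tinv (z : ℝ × Bool) : ℝ × Bool := s2 (L.T (s2 z))

theorem Tinv_T {z : ℝ × Bool} (h : z ∈ L.Ihat) (h' : z ∉ L.Sig) : L.Tinv (L.T z) = z := by
  rw [Tinv, T_s2_T h h', s2_s2]

theorem continuousAt_Tinv {z : ℝ × Bool} (h : z ∈ L.Ihat) (h' : z ∉ L.Sig) :
    ContinuousAt L.Tinv (L.T z) := by
  have h1 : ContinuousAt L.T (s2 (L.T z)) :=
    continuousAt_T (s2_mem_Ihat.2 (T_mem_Ihat h h')) (s2_T_notMem_Sig h h')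
  have h2 : ContinuousAt (fun q => L.T (s2 q)) (L.T z) :=
    ContinuousAt.comp (g := L.T) (f := s2) h1 continuous_s2.continuousAt
  exact ContinuousAt.comp (g := s2) (f := fun q => L.T (s2 q)) continuous_s2.continuousAt h2

theorem tendsto_Tinv {z : ℝ × Bool} (h : z ∈ L.Ihat) (h' : z ∉ L.Sig) :
    Tendsto L.Tinv (𝓝 (L.T z)) (𝓝 z) := by
  have := continuousAt_Tinv h h'
  rwa [ContinuousAt, Tinv_T h h'] at this

theorem eventually_Tinv {z : ℝ × Bool} (h : z ∈ L.Ihat) (h' : z ∉ L.Sig) :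
    ∀ᶠ q in 𝓝 (L.T z), L.T (L.Tinv q) = q := by
  have h1 := T_mem_Ihat h h'
  obtain ⟨c, hc⟩ := exists_mem_Ia (s2_mem_Ihat.2 h1) (s2_T_notMem_Sig h h')
  have h2 : ∀ᶠ q in 𝓝 (L.T z), s2 q ∈ L.Ia c :=
    continuous_s2.continuousAt.eventually ((L.isOpen_Ia c).mem_nhds hc)
  filter_upwards [h2] with q hq
  have := T_s2_T (mem_Ihat_of_mem_Ia hq) (notMem_Sig_of_mem_Ia hq)
  simpa [Tinv] using this

/-- A property which is locally true at `T z` is locally true at `z` after composition. -/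
theorem eventually_T {z : ℝ × Bool} (h : z ∈ L.Ihat) (h' : z ∉ L.Sig) {p : ℝ × Bool → Prop} :
    (∀ᶠ q in 𝓝 (L.T z), p q) ↔ ∀ᶠ q in 𝓝 z, p (L.T q) := by
  constructor
  · intro hp
    exact (continuousAt_T h h').eventually hp
  · intro hp
    filter_upwards [(tendsto_Tinv h h').eventually hp, eventually_Tinv h h'] with q hq hq'
    rwa [hq'] at hq

theorem eventually_regular {z : ℝ × Bool} (h : z ∈ L.Ihat) (h' : z ∉ L.Sig) :
    ∀ᶠ q in 𝓝 z, q ∈ L.Ihat ∧ q ∉ L.Sig := by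
  obtain ⟨c, hc⟩ := exists_mem_Ia h h'
  filter_upwards [(L.isOpen_Ia c).mem_nhds hc] with q hq
  exact ⟨mem_Ihat_of_mem_Ia hq, notMem_Sig_of_mem_Ia hq⟩

variable (L) in
/-- The orbit of `z` stays regular during `N` steps. -/
def Reg (N : ℕ) (z : ℝ × Bool) : Prop := z ∈ L.Ihat ∧ ∀ j < N, (L.T)^[j] z ∉ L.Sig

theorem Reg.mono {N M : ℕ} {z : ℝ × Bool} (h : L.Reg N z) (hM : M ≤ N) : L.Reg M z :=
  ⟨h.1, fun j hj => h.2 j (hj.trans_le hM)⟩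

theorem reg_succ {N : ℕ} {z : ℝ × Bool} :
    L.Reg (N + 1) z ↔ z ∈ L.Ihat ∧ z ∉ L.Sig ∧ L.Reg N (L.T z) := by
  constructor
  · intro h
    have h0 : z ∉ L.Sig := h.2 0 (Nat.succ_pos _)
    exact ⟨h.1, h0, T_mem_Ihat h.1 h0, fun j hj => h.2 (j + 1) (Nat.succ_lt_succ hj)⟩
  · rintro ⟨h, h0, h1⟩
    refine ⟨h, fun j hj => ?_⟩
    cases j with
    | zero => exact h0
    | succ j => exact h1.2 j (Nat.lt_of_succ_lt_succ hj)

theorem Reg.iterate {m : ℕ} : ∀ {N : ℕ} {z : ℝ × Bool}, L.Reg (m + N) z →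
    L.Reg N ((L.T)^[m] z) := by
  induction m with
  | zero => intro N z h; simpa using h
  | succ m ih =>
    intro N z h
    rw [show m + 1 + N = (m + N) + 1 by ring, reg_succ] at h
    exact ih h.2.2

theorem Reg.add {m : ℕ} : ∀ {N : ℕ} {z : ℝ × Bool}, L.Reg m z → L.Reg N ((L.T)^[m] z) →
    L.Reg (m + N) z := by
  induction m with
  | zero => intro N z _ h; simpa using h
  | succ m ih =>
    intro N z h h'
    rw [show m + 1 + N = (m + N) + 1 by ring, reg_succ]
    rw [reg_succ] at h
    exact ⟨h.1, h.2.1, ih h.2.2 h'⟩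

theorem Reg.mem_Ihat {N j : ℕ} {z : ℝ × Bool} (h : L.Reg N z) (hj : j ≤ N) :
    (L.T)^[j] z ∈ L.Ihat :=
  (Reg.iterate (N := N - j) (by rwa [Nat.add_sub_cancel' hj])).1

theorem Reg.continuousAt {N : ℕ} : ∀ {z : ℝ × Bool}, L.Reg N z → ContinuousAt (L.T)^[N] z := by
  induction N with
  | zero => intro z _; exact continuousAt_id
  | succ N ih =>
    intro z h
    rw [reg_succ] at h
    exact ContinuousAt.comp (f := L.T) (ih h.2.2) (continuousAt_T h.1 h.2.1)

theorem Reg.eventually {N : ℕ} : ∀ {z : ℝ × Bool}, L.Reg N z → ∀ᶠ q in 𝓝 z, L.Reg N q := by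
  induction N with
  | zero =>
    intro z h
    filter_upwards [L.isOpen_Ihat.mem_nhds h.1] with q hq
    exact ⟨hq, fun j hj => absurd hj (Nat.not_lt_zero _)⟩
  | succ N ih =>
    intro z h
    rw [reg_succ] at h
    filter_upwards [eventually_regular h.1 h.2.1,
      (eventually_T h.1 h.2.1).1 (ih h.2.2)] with q hq hq'
    rw [reg_succ]
    exact ⟨hq.1, hq.2, hq'⟩

theorem Reg.inj {N : ℕ} : ∀ {z z' : ℝ × Bool}, L.Reg N z → L.Reg N z' →
    (L.T)^[N] z = (L.T)^[N] z' → z = z' := by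
  induction N with
  | zero => intro z z' _ _ h; exact h
  | succ N ih =>
    intro z z' h h' e
    rw [reg_succ] at h h'
    exact T_inj h.1 h.2.1 h'.1 h'.2.1 (ih h.2.2 h'.2.2 e)

theorem Reg.exists_affine {N : ℕ} : ∀ {z : ℝ × Bool}, L.Reg N z →
    ∃ (s α : ℝ) (δ : Bool), (s = 1 ∨ s = -1) ∧ ∀ᶠ q in 𝓝 z, (L.T)^[N] q = (s * q.1 + α, δ) := by
  induction N with
  | zero =>
    intro z _
    refine ⟨1, 0, z.2, Or.inl rfl, ?_⟩
    obtain ⟨x, δ⟩ := z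
    rw [eventually_nhds_prod_bool]
    simp
  | succ N ih =>
    intro z h
    rw [reg_succ] at h
    obtain ⟨s, α, δ, hs1, hs⟩ := ih h.2.2
    obtain ⟨c, hc⟩ := exists_mem_Ia h.1 h.2.1
    obtain ⟨t, β, ht, hT⟩ := L.exists_T_eq c
    refine ⟨s * t, s * β + α, δ, ?_, ?_⟩
    · rcases hs1 with rfl | rfl <;> rcases ht with rfl | rfl <;> simp
    filter_upwards [(L.isOpen_Ia c).mem_nhds hc, (eventually_T h.1 h.2.1).1 hs] with q hq hq'
    rw [Function.iterate_succ_apply, hq', hT q hq]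
    simp; ring

/-- Reversal of orbits by `σ₂`. -/
theorem Reg.reverse {N : ℕ} {z : ℝ × Bool} (h : L.Reg N z) :
    L.Reg N (s2 ((L.T)^[N] z)) ∧
      ∀ i ≤ N, (L.T)^[i] (s2 ((L.T)^[N] z)) = s2 ((L.T)^[N - i] z) := by
  induction N with
  | zero =>
    refine ⟨⟨s2_mem_Ihat.2 h.1, fun j hj => absurd hj (Nat.not_lt_zero _)⟩, fun i hi => ?_⟩
    obtain rfl : i = 0 := by omega
    rfl
  | succ N ih =>
    have hN := h.mono (Nat.le_succ N)
    obtain ⟨h1, h2⟩ := ih hN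
    have h3 : (L.T)^[N] z ∈ L.Ihat := hN.mem_Ihat le_rfl
    have h4 : (L.T)^[N] z ∉ L.Sig := h.2 N (Nat.lt_succ_self N)
    have h5 : L.T (s2 ((L.T)^[N + 1] z)) = s2 ((L.T)^[N] z) := by
      rw [Function.iterate_succ_apply', T_s2_T h3 h4]
    refine ⟨?_, fun i hi => ?_⟩
    · rw [reg_succ, h5]
      refine ⟨s2_mem_Ihat.2 (h.mem_Ihat le_rfl), ?_, h1⟩
      rw [Function.iterate_succ_apply']
      exact s2_T_notMem_Sig h3 h4
    · cases i with
      | zero => rfl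
      | succ i =>
        rw [Function.iterate_succ_apply, h5, h2 i (by omega)]
        rw [show N + 1 - (i + 1) = N - i by omega]

variable (L) in
/-- The forward orbit of `z` is infinite. -/
def FwdInf (z : ℝ × Bool) : Prop := z ∈ L.Ihat ∧ ∀ j, (L.T)^[j] z ∉ L.Sig

theorem FwdInf.reg {z : ℝ × Bool} (h : L.FwdInf z) (N : ℕ) : L.Reg N z := ⟨h.1, fun j _ => h.2 j⟩

theorem FwdInf.iterate {z : ℝ × Bool} (h : L.FwdInf z) (m : ℕ) : L.FwdInf ((L.T)^[m] z) :=
  ⟨(h.reg m).mem_Ihat le_rfl, fun j => by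
    rw [← Function.iterate_add_apply]; exact h.2 _⟩

theorem exists_first_Sig {z : ℝ × Bool} (hz : z ∈ L.Ihat) (h : ¬ L.FwdInf z) :
    ∃ n, L.Reg n z ∧ (L.T)^[n] z ∈ L.Sig := by
  classical
  have h1 : ∃ n, (L.T)^[n] z ∈ L.Sig := by
    by_contra hcon
    push Not at hcon
    exact h ⟨hz, hcon⟩
  exact ⟨Nat.find h1, ⟨hz, fun j hj => Nat.find_min h1 hj⟩, Nat.find_spec h1⟩

theorem fwdInf_or (hnc : ¬ L.HasConnection) {z : ℝ × Bool} (hz : z ∈ L.Ihat) :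
    L.FwdInf z ∨ L.FwdInf (s2 z) := by
  by_contra hcon
  push Not at hcon
  obtain ⟨n, hn, hn'⟩ := exists_first_Sig hz hcon.1
  obtain ⟨m, hm, hm'⟩ := exists_first_Sig (s2_mem_Ihat.2 hz) hcon.2
  apply hnc
  refine ⟨_, ⟨_, hm', rfl⟩, m + n, ?_⟩
  rw [Nat.add_comm, Function.iterate_add_apply, hm.reverse.2 m le_rfl]
  simpa using hn'

variable (L) in
/-- Sets invariant under the partial bijection `T`. -/
def Inv (W : Set (ℝ × Bool)) : Prop := ∀ z ∈ L.Ihat, z ∉ L.Sig → (z ∈ W ↔ L.T z ∈ W)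

theorem Inv.s2 {W : Set (ℝ × Bool)} (h : L.Inv W) : L.Inv (s2 ⁻¹' W) := by
  intro z hz hz'
  have h1 := h (LinInv.s2 (L.T z)) (s2_mem_Ihat.2 (T_mem_Ihat hz hz')) (s2_T_notMem_Sig hz hz')
  rw [T_s2_T hz hz'] at h1
  exact h1.symm

theorem Inv.iterate {W : Set (ℝ × Bool)} (h : L.Inv W) {z : ℝ × Bool} {n : ℕ} (hz : L.Reg n z) :
    z ∈ W ↔ (L.T)^[n] z ∈ W := by
  induction n with
  | zero => rfl
  | succ n ih =>
    rw [ih (hz.mono (Nat.le_succ n)), Function.iterate_succ_apply']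
    exact h _ ((hz.mono (Nat.le_succ n)).mem_Ihat le_rfl) (hz.2 n (Nat.lt_succ_self n))

theorem isPreconnected_component (δ : Bool) :
    IsPreconnected (Ioo L.lo L.hi ×ˢ ({δ} : Set Bool)) :=
  isPreconnected_Ioo.prod isPreconnected_singleton

theorem eventually_snd_eq (z : ℝ × Bool) : ∀ᶠ q in 𝓝 z, q.2 = z.2 := by
  obtain ⟨x, δ⟩ := z
  rw [eventually_nhds_prod_bool]
  simp

/-- An affine map of slope `±1` fixing all points of a nonempty open set is trivial. -/
theorem affine_eq_id {s α : ℝ} {δ : Bool} {q : ℝ × Bool} (hs : s = 1 ∨ s = -1)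
    (h : ∀ᶠ q' in 𝓝 q, (s * q'.1 + α, δ) = q') : s = 1 ∧ α = 0 ∧ δ = q.2 := by
  have h0 := h.self_of_nhds
  obtain ⟨x, ε⟩ := q
  rw [eventually_nhds_prod_bool] at h
  obtain ⟨r, hr, hb⟩ := Metric.eventually_nhds_iff.1 h
  have h1 := hb (y := x + r / 2) (by
    rw [Real.dist_eq, add_sub_cancel_left, abs_of_pos (by positivity)]; linarith)
  simp only [Prod.mk.injEq] at h0 h1
  refine ⟨?_, ?_, h0.2⟩
  · rcases hs with h | rfl
    · exact h
    · exfalso; linarith [h0.1, h1.1]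
  · rcases hs with rfl | rfl
    · linarith [h0.1]
    · exfalso; linarith [h0.1, h1.1]

theorem eventually_iterate_two_mul {n : ℕ} {z : ℝ × Bool} (hz : L.Reg n z)
    (he : (L.T)^[n] z = z) : ∀ᶠ q in 𝓝 z, L.Reg (n + n) q ∧ (L.T)^[n + n] q = q := by
  have h2 : L.Reg (n + n) z := hz.add (by rwa [he])
  obtain ⟨s, α, δ, hs, ha⟩ := hz.exists_affine
  have ha0 := ha.self_of_nhds
  rw [he] at ha0
  have hc : Tendsto (L.T)^[n] (𝓝 z) (𝓝 z) := by
    have := hz.continuousAt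
    rwa [ContinuousAt, he] at this
  filter_upwards [h2.eventually, ha, hc.eventually ha, eventually_snd_eq z] with q h3 h4 h5 h6
  refine ⟨h3, ?_⟩
  rw [Function.iterate_add_apply, h5, h4]
  obtain ⟨x, ε⟩ := q
  obtain ⟨y, ε'⟩ := z
  simp only [Prod.mk.injEq] at *
  rcases hs with rfl | rfl
  · exact ⟨by linarith [ha0.1], by rw [h6, ha0.2]⟩
  · exact ⟨by linarith [ha0.1], by rw [h6, ha0.2]⟩

variable (L) in
/-- Regular points of period dividing `N`. -/
def Per (N : ℕ) : Set (ℝ × Bool) := {q | L.Reg N q ∧ (L.T)^[N] q = q}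

theorem s2_mem_interior_per {N : ℕ} {q : ℝ × Bool} (h : q ∈ interior (L.Per N)) :
    s2 q ∈ interior (L.Per N) := by
  have h1 : ∀ q ∈ L.Per N, s2 q ∈ L.Per N := by
    rintro q ⟨hq, he⟩
    obtain ⟨h2, h3⟩ := hq.reverse
    have h4 := h3 N le_rfl
    rw [he] at h2 h4
    exact ⟨h2, by simpa using h4⟩
  rw [mem_interior_iff_mem_nhds] at h ⊢
  have h5 : Tendsto s2 (𝓝 (s2 q)) (𝓝 q) := by
    have := continuous_s2.tendsto (s2 q)
    rwa [s2_s2] at this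
  filter_upwards [h5.eventually h] with q' hq'
  have := h1 _ hq'
  rwa [s2_s2] at this

theorem closure_interior_per (hnc : ¬ L.HasConnection) (N : ℕ) :
    closure (interior (L.Per N)) ∩ L.Ihat ⊆ interior (L.Per N) := by
  have key : ∀ p ∈ closure (interior (L.Per N)), L.FwdInf p → p ∈ interior (L.Per N) := by
    intro p hp hf
    obtain ⟨s, α, δ, hs, ha⟩ := (hf.reg N).exists_affine
    obtain ⟨q, hq, hq1, hq2⟩ := ((mem_closure_iff_frequently.1 hp).and_eventually
      ((eventually_eventually_nhds.2 ha).and (eventually_snd_eq p))).exists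
    obtain ⟨rfl, rfl, rfl⟩ := affine_eq_id hs (q := q) (by
      filter_upwards [hq1, isOpen_interior.mem_nhds hq] with q' h1 h2
      rw [← h1]
      exact (interior_subset h2).2)
    rw [mem_interior_iff_mem_nhds]
    filter_upwards [ha, (hf.reg N).eventually, eventually_snd_eq p] with q' h1 h2 h3
    refine ⟨h2, ?_⟩
    rw [h1, hq2, ← h3]
    simp
  rintro p ⟨hp, hI⟩
  rcases fwdInf_or hnc hI with h | h
  · exact key p hp h
  · have := key (s2 p) (map_mem_closure continuous_s2 hp fun q hq => s2_mem_interior_per hq) h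
    simpa using s2_mem_interior_per this

theorem Reg.iterate_ne (hnc : ¬ L.HasConnection) (hne : L.Sig.Nonempty) {n : ℕ} (hn : 0 < n)
    {z : ℝ × Bool} (hz : L.Reg n z) : (L.T)^[n] z ≠ z := by
  intro he
  set V := interior (L.Per (n + n)) with hV
  have hzV : z ∈ V := mem_interior_iff_mem_nhds.2 (eventually_iterate_two_mul hz he)
  have hsub : Ioo L.lo L.hi ×ˢ ({z.2} : Set Bool) ⊆ V := by
    refine (isPreconnected_component (L := L) z.2).subset_of_closure_inter_subset
      isOpen_interior ⟨z, ⟨LinearInvolution.mem_Ihat.1 hz.1, rfl⟩, hzV⟩ ?_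
    rintro q ⟨h1, h2⟩
    exact closure_interior_per hnc _ ⟨h1, h2.1, mem_univ _⟩
  obtain ⟨σ, hσ⟩ := hne
  have hσV : σ ∈ V := by
    rcases Bool.eq_or_eq_not σ.2 z.2 with h | h
    · exact hsub ⟨(L.Sig_sub hσ).1, h⟩
    · have : s2 σ ∈ V := hsub ⟨(L.Sig_sub hσ).1, by simp [s2, h]⟩
      simpa using s2_mem_interior_per this
  exact (interior_subset hσV).1.2 0 (by omega) hσ

theorem FwdInf.iterate_injective (hnc : ¬ L.HasConnection) (hne : L.Sig.Nonempty)
    {z : ℝ × Bool} (hz : L.FwdInf z) {i j : ℕ} (h : (L.T)^[i] z = (L.T)^[j] z) : i = j := by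
  wlog hij : i < j generalizing i j
  · rcases lt_trichotomy i j with h1 | h1 | h1
    · exact this h h1
    · exact h1
    · exact (this h.symm h1).symm
  obtain ⟨d, rfl⟩ := Nat.exists_eq_add_of_lt hij
  refine absurd ?_ (((hz.iterate i).reg (d + 1)).iterate_ne hnc hne (Nat.succ_pos d))
  rw [← Function.iterate_add_apply, h]
  congr 1
  omega

theorem right_end_mem_Sig {c : Letter A} (h : L.endHi c < L.hi) :
    (L.endHi c, L.comp c) ∈ L.Sig := by
  by_contra hS
  have hI : (L.endHi c, L.comp c) ∈ L.Ihat :=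
    mem_Ihat.2 ⟨(L.sub_lo c).trans_lt (L.end_lt c), h⟩
  obtain ⟨d, hd⟩ := exists_mem_Ia hI hS
  rw [mem_Ia] at hd
  have h1 := L.end_lt c
  set x := max ((L.endLo c + L.endHi c) / 2) ((L.endLo d + L.endHi c) / 2) with hx
  have h2 : x < L.endHi c := max_lt (by linarith) (by linarith [hd.1.1])
  have h3 : (L.endLo c + L.endHi c) / 2 ≤ x := le_max_left _ _
  have h4 : (L.endLo d + L.endHi c) / 2 ≤ x := le_max_right _ _
  have h5 : ((x, L.comp c) : ℝ × Bool) ∈ L.Ia c := mem_Ia.2 ⟨⟨by linarith, h2⟩, rfl⟩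
  have h6 : ((x, L.comp c) : ℝ × Bool) ∈ L.Ia d :=
    mem_Ia.2 ⟨⟨by linarith [hd.1.1], by linarith [hd.1.2]⟩, hd.2⟩
  obtain rfl := eq_of_mem_Ia h5 h6
  exact lt_irrefl _ hd.1.2

theorem left_end_mem_Sig {c : Letter A} (h : L.lo < L.endLo c) :
    (L.endLo c, L.comp c) ∈ L.Sig := by
  by_contra hS
  have hI : (L.endLo c, L.comp c) ∈ L.Ihat :=
    mem_Ihat.2 ⟨h, (L.end_lt c).trans_le (L.sub_hi c)⟩
  obtain ⟨d, hd⟩ := exists_mem_Ia hI hS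
  rw [mem_Ia] at hd
  have h1 := L.end_lt c
  set x := min ((L.endLo c + L.endHi c) / 2) ((L.endLo c + L.endHi d) / 2) with hx
  have h2 : L.endLo c < x := lt_min (by linarith) (by linarith [hd.1.2])
  have h3 : x ≤ (L.endLo c + L.endHi c) / 2 := min_le_left _ _
  have h4 : x ≤ (L.endLo c + L.endHi d) / 2 := min_le_right _ _
  have h5 : ((x, L.comp c) : ℝ × Bool) ∈ L.Ia c := mem_Ia.2 ⟨⟨h2, by linarith⟩, rfl⟩
  have h6 : ((x, L.comp c) : ℝ × Bool) ∈ L.Ia d :=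
    mem_Ia.2 ⟨⟨by linarith [hd.1.1], by linarith [hd.1.2]⟩, hd.2⟩
  obtain rfl := eq_of_mem_Ia h5 h6
  exact lt_irrefl _ hd.1.1

/-- `W` contains a one-sided open neighbourhood of length `l` of `p ∉ W`, in direction `s`. -/
def Adj (W : Set (ℝ × Bool)) (p : ℝ × Bool) (s l : ℝ) : Prop :=
  (s = 1 ∨ s = -1) ∧ 0 < l ∧ p ∉ W ∧ ∀ t, 0 < t → t < l → (p.1 + s * t, p.2) ∈ W

theorem Adj.mono {W : Set (ℝ × Bool)} {p : ℝ × Bool} {s l l' : ℝ} (h : Adj W p s l) (h0 : 0 < l')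
    (h' : l' ≤ l) : Adj W p s l' :=
  ⟨h.1, h0, h.2.2.1, fun t ht ht' => h.2.2.2 t ht (ht'.trans_le h')⟩

theorem Adj.map {W : Set (ℝ × Bool)} (hW : L.Inv W) {p : ℝ × Bool} {c : Letter A} (hp : p ∈ L.Ia c)
    {s l : ℝ} (h : Adj W p s l) (hI : ∀ t, 0 < t → t < l → (p.1 + s * t, p.2) ∈ L.Ia c) :
    ∃ s', Adj W (L.T p) s' l := by
  obtain ⟨r, α, hr, hT⟩ := L.exists_T_eq c
  refine ⟨r * s, ?_, h.2.1, ?_, fun t ht ht' => ?_⟩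
  · rcases hr with rfl | rfl <;> rcases h.1 with rfl | rfl <;> simp
  · rw [← hW p (mem_Ihat_of_mem_Ia hp) (notMem_Sig_of_mem_Ia hp)]
    exact h.2.2.1
  · have h1 := hI t ht ht'
    have h2 := (hW _ (mem_Ihat_of_mem_Ia h1) (notMem_Sig_of_mem_Ia h1)).1 (h.2.2.2 t ht ht')
    rw [hT _ h1] at h2
    rw [hT _ hp]
    convert h2 using 2
    simp only
    ring

theorem Adj.map_small {W : Set (ℝ × Bool)} (hW : L.Inv W) {p : ℝ × Bool} (hp : p ∈ L.Ihat)
    (hp' : p ∉ L.Sig) {s l : ℝ} (h : Adj W p s l) : ∃ s' l', Adj W (L.T p) s' l' := by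
  obtain ⟨c, hc⟩ := exists_mem_Ia hp hp'
  have hc' := mem_Ia.1 hc
  set l' := min l (min (p.1 - L.endLo c) (L.endHi c - p.1)) with hl'
  have h1 : l' ≤ l := min_le_left _ _
  have h2 : l' ≤ p.1 - L.endLo c := (min_le_right _ _).trans (min_le_left _ _)
  have h3 : l' ≤ L.endHi c - p.1 := (min_le_right _ _).trans (min_le_right _ _)
  have h4 : 0 < l' := lt_min h.2.1 (lt_min (by linarith [hc'.1.1]) (by linarith [hc'.1.2]))
  obtain ⟨s', hs'⟩ := (h.mono h4 h1).map hW hc fun t ht ht' => by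
    rw [mem_Ia]
    rcases h.1 with rfl | rfl
    · exact ⟨⟨by simp only; linarith, by simp only; linarith⟩, hc'.2⟩
    · exact ⟨⟨by simp only; linarith, by simp only; linarith⟩, hc'.2⟩
  exact ⟨s', l', hs'⟩

theorem Adj.map_of_notMem_Sig {W : Set (ℝ × Bool)} (hWI : W ⊆ L.Ihat) (hW : L.Inv W)
    {p : ℝ × Bool} (hp : p ∈ L.Ihat) (hp' : p ∉ L.Sig) {s l : ℝ} (h : Adj W p s l)
    (hS : ∀ t, 0 < t → t < l → (p.1 + s * t, p.2) ∉ L.Sig) : ∃ s', Adj W (L.T p) s' l := by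
  obtain ⟨c, hc⟩ := exists_mem_Ia hp hp'
  have hc' := mem_Ia.1 hc
  refine h.map hW hc fun t ht ht' => ?_
  have hI := mem_Ihat.1 (hWI (h.2.2.2 t ht ht'))
  rw [mem_Ia]
  refine ⟨?_, hc'.2⟩
  simp only at hI ⊢
  rcases h.1 with rfl | rfl
  · refine ⟨by linarith [hc'.1.1], ?_⟩
    by_contra hcon
    push Not at hcon
    rcases hcon.eq_or_lt with h1 | h1
    · refine hS t ht ht' ?_
      rw [← h1, hc'.2]
      exact right_end_mem_Sig (by linarith [hI.2])
    · refine hS (L.endHi c - p.1) (by linarith [hc'.1.2]) (by linarith) ?_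
      rw [show p.1 + 1 * (L.endHi c - p.1) = L.endHi c by ring, hc'.2]
      exact right_end_mem_Sig (by linarith [hI.2])
  · refine ⟨?_, by linarith [hc'.1.2]⟩
    by_contra hcon
    push Not at hcon
    rcases hcon.eq_or_lt with h1 | h1
    · refine hS t ht ht' ?_
      rw [h1, hc'.2]
      exact left_end_mem_Sig (by linarith [hI.1])
    · refine hS (p.1 - L.endLo c) (by linarith [hc'.1.1]) (by linarith) ?_
      rw [show p.1 + -1 * (p.1 - L.endLo c) = L.endLo c by ring, hc'.2]
      exact left_end_mem_Sig (by linarith [hI.1])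

theorem FwdInf.exists_adj {W : Set (ℝ × Bool)} (hW : L.Inv W) {p : ℝ × Bool} (hp : L.FwdInf p)
    {s l : ℝ} (h : Adj W p s l) (i : ℕ) : ∃ s' l', Adj W ((L.T)^[i] p) s' l' := by
  induction i with
  | zero => exact ⟨s, l, h⟩
  | succ i ih =>
    obtain ⟨s', l', h'⟩ := ih
    rw [Function.iterate_succ_apply']
    exact h'.map_small hW (hp.iterate i).1 (hp.2 i)

theorem FwdInf.not_adj (hnc : ¬ L.HasConnection) (hfin : L.Sig.Finite) (hne : L.Sig.Nonempty)
    {W : Set (ℝ × Bool)} (hWI : W ⊆ L.Ihat) (hW : L.Inv W) {p : ℝ × Bool} (hp : L.FwdInf p)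
    {s l : ℝ} (h : Adj W p s l) : False := by
  have hpW : ∀ i, (L.T)^[i] p ∉ W := fun i hi => h.2.2.1 ((hW.iterate (hp.reg i)).2 hi)
  set bad : ℝ × Bool → ℝ → Set ℕ := fun σ s => {i | ∃ t, 0 < t ∧
    (((L.T)^[i] p).1 + s * t, ((L.T)^[i] p).2) = σ ∧
    ∀ t', 0 < t' → t' ≤ t → (((L.T)^[i] p).1 + s * t', ((L.T)^[i] p).2) ∈ W} with hbad
  have hsub : ∀ σ s, (bad σ s).Subsingleton := by
    rintro σ s i ⟨t, ht, he, ha⟩ j ⟨u, hu, he', ha'⟩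
    have h1 : ((L.T)^[i] p).1 + s * t = ((L.T)^[j] p).1 + s * u :=
      (Prod.ext_iff.1 (he.trans he'.symm)).1
    have h2 : ((L.T)^[i] p).2 = ((L.T)^[j] p).2 := (Prod.ext_iff.1 (he.trans he'.symm)).2
    rcases lt_trichotomy t u with h3 | h3 | h3
    · exfalso
      apply hpW i
      have := ha' (u - t) (by linarith) (by linarith)
      convert this using 1
      exact Prod.ext (by simp only; linarith) h2
    · subst h3
      exact hp.iterate_injective hnc hne (Prod.ext (by linarith) h2)
    · exfalso
      apply hpW j
      have := ha (t - u) (by linarith) (by linarith)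
      convert this using 1
      exact Prod.ext (by simp only; linarith) h2.symm
  have hbfin : (⋃ σ ∈ L.Sig, (bad σ 1 ∪ bad σ (-1))).Finite :=
    hfin.biUnion fun σ _ => (hsub σ 1).finite.union (hsub σ (-1)).finite
  obtain ⟨i₀, hi₀⟩ := hbfin.bddAbove
  obtain ⟨s₀, l₀, h₀⟩ := hp.exists_adj hW h (i₀ + 1)
  have hall : ∀ m, ∃ s', Adj W ((L.T)^[m + (i₀ + 1)] p) s' l₀ := by
    intro m
    induction m with
    | zero => exact ⟨s₀, by simpa using h₀⟩
    | succ m ih =>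
      obtain ⟨s', hs'⟩ := ih
      rw [show m + 1 + (i₀ + 1) = (m + (i₀ + 1)) + 1 by omega, Function.iterate_succ_apply']
      refine hs'.map_of_notMem_Sig hWI hW (hp.iterate _).1 (hp.2 _) fun t ht ht' hσ => ?_
      have hb : m + (i₀ + 1) ∈ bad (((L.T)^[m + (i₀ + 1)] p).1 + s' * t,
          ((L.T)^[m + (i₀ + 1)] p).2) s' :=
        ⟨t, ht, rfl, fun t' h1 h2 => hs'.2.2.2 t' h1 (h2.trans_lt ht')⟩
      have := hi₀ (mem_iUnion₂.2 ⟨_, hσ, by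
        rcases hs'.1 with rfl | rfl
        · exact Or.inl hb
        · exact Or.inr hb⟩)
      omega
  choose s' hs' using hall
  have hl₀ := h₀.2.1
  have hmem : ∀ m, ⌊((L.T)^[m + (i₀ + 1)] p).1 / l₀⌋ ∈ Icc ⌊L.lo / l₀⌋ ⌊L.hi / l₀⌋ := by
    intro m
    have := mem_Ihat.1 (hp.iterate (m + (i₀ + 1))).1
    exact ⟨Int.floor_le_floor (by gcongr; exact this.1.le),
      Int.floor_le_floor (by gcongr; exact this.2.le)⟩
  classical
  let f : ℕ → Bool × Bool × Icc ⌊L.lo / l₀⌋ ⌊L.hi / l₀⌋ := fun m =>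
    (((L.T)^[m + (i₀ + 1)] p).2, decide (s' m = 1), ⟨_, hmem m⟩)
  obtain ⟨m, n, hmn, he⟩ := Finite.exists_ne_map_eq_of_infinite f
  simp only [f, Prod.mk.injEq, Subtype.mk.injEq, decide_eq_decide] at he
  obtain ⟨he1, he2, he3⟩ := he
  have hs : s' m = s' n := by
    rcases (hs' m).1 with h1 | h1
    · rw [h1, he2.1 h1]
    · rcases (hs' n).1 with h2 | h2
      · rw [h2, he2.2 h2]
      · rw [h1, h2]
  have h4 := Int.abs_sub_lt_one_of_floor_eq_floor he3
  rw [← sub_div, abs_div, abs_of_pos hl₀, div_lt_one hl₀] at h4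
  have h5 : ((L.T)^[m + (i₀ + 1)] p).1 ≠ ((L.T)^[n + (i₀ + 1)] p).1 := by
    intro h6
    have := hp.iterate_injective hnc hne (Prod.ext h6 he1)
    omega
  have h7 := abs_lt.1 h4
  have hm := (hs' m).2.2.2
  have hn := (hs' n).2.2.2
  set x := (L.T)^[m + (i₀ + 1)] p with hx
  set y := (L.T)^[n + (i₀ + 1)] p with hy
  have key : ∀ a b : ℝ × Bool, a ∉ W → b.2 = a.2 → |a.1 - b.1| < l₀ → ∀ s, (s = 1 ∨ s = -1) →
      0 < s * (a.1 - b.1) → (∀ t, 0 < t → t < l₀ → (b.1 + s * t, b.2) ∈ W) → False := by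
    intro a b ha hab hd s hs hpos hW'
    apply ha
    have hlt := abs_lt.1 hd
    have := hW' (s * (a.1 - b.1)) hpos (by rcases hs with rfl | rfl <;> linarith)
    convert this using 1
    refine Prod.ext ?_ hab.symm
    rcases hs with rfl | rfl <;> simp
  rcases lt_or_gt_of_ne h5 with h6 | h6 <;> rcases (hs' n).1 with h8 | h8 <;> rw [h8] at hs hn <;>
    rw [hs] at hm
  · exact key y x (hpW _) he1 (by rwa [abs_sub_comm]) 1 (Or.inl rfl) (by linarith) hm
  · exact key x y (hpW _) he1.symm h4 (-1) (Or.inr rfl) (by linarith) hn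
  · exact key x y (hpW _) he1.symm h4 1 (Or.inl rfl) (by linarith) hn
  · exact key y x (hpW _) he1 (by rwa [abs_sub_comm]) (-1) (Or.inr rfl) (by linarith) hm

/-- Minimality: an open invariant set is a union of components of `Î`. -/
theorem Inv.mem_of_mem (hnc : ¬ L.HasConnection) (hfin : L.Sig.Finite) (hne : L.Sig.Nonempty)
    {W : Set (ℝ × Bool)} (hWo : IsOpen W) (hWI : W ⊆ L.Ihat) (hW : L.Inv W) {q q' : ℝ × Bool}
    (hq : q ∈ W) (hq' : q' ∈ L.Ihat) (he : q'.2 = q.2) : q' ∈ W := by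
  by_contra hcon
  have hne1 : q'.1 ≠ q.1 := fun h => hcon (by rwa [show q' = q from Prod.ext h he])
  obtain ⟨s, D, hs, hD, hqq⟩ : ∃ s D : ℝ, (s = 1 ∨ s = -1) ∧ 0 < D ∧ q'.1 = q.1 + s * D := by
    rcases lt_or_gt_of_ne hne1 with h | h
    · exact ⟨-1, q.1 - q'.1, Or.inr rfl, by linarith, by ring⟩
    · exact ⟨1, q'.1 - q.1, Or.inl rfl, by linarith, by ring⟩
  set B : Set ℝ := Icc 0 D ∩ (fun t => ((q.1 + s * t, q.2) : ℝ × Bool)) ⁻¹' Wᶜ with hB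
  have hBc : IsClosed B := isClosed_Icc.inter (hWo.isClosed_compl.preimage (by fun_prop))
  have hBn : B.Nonempty := ⟨D, ⟨hD.le, le_rfl⟩, by
    rw [mem_preimage, ← hqq, ← he]; exact hcon⟩
  have hBb : BddBelow B := ⟨0, fun t ht => ht.1.1⟩
  set t₀ := sInf B with ht₀
  have hmem : t₀ ∈ B := hBc.csInf_mem hBn hBb
  have h0 : 0 < t₀ := by
    refine lt_of_le_of_ne hmem.1.1 fun h => hmem.2 ?_
    rw [← h]
    simpa using hq
  set p : ℝ × Bool := (q.1 + s * t₀, q.2) with hp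
  have hadj : Adj W p (-s) t₀ := by
    refine ⟨by rcases hs with rfl | rfl <;> simp, h0, hmem.2, fun t ht ht' => ?_⟩
    by_contra hc
    have : t₀ - t ∈ B := by
      refine ⟨⟨by linarith, by linarith [hmem.1.2]⟩, ?_⟩
      rw [mem_preimage, show q.1 + s * (t₀ - t) = p.1 + -s * t by simp only [hp]; ring]
      exact hc
    linarith [csInf_le hBb this]
  have hpI : p ∈ L.Ihat := by
    have h1 := mem_Ihat.1 (hWI hq)
    have h2 := mem_Ihat.1 hq'
    rw [mem_Ihat]
    have h3 := hmem.1.2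
    simp only [hp]
    rcases hs with rfl | rfl <;> constructor <;> linarith
  rcases fwdInf_or hnc hpI with h | h
  · exact h.not_adj hnc hfin hne hWI hW hadj
  · refine h.not_adj hnc hfin hne (W := LinInv.s2 ⁻¹' W) (fun z hz => s2_mem_Ihat.1 (hWI hz))
      hW.s2 (s := -s) (l := t₀) ⟨hadj.1, h0, ?_, fun t ht ht' => ?_⟩
    · rw [mem_preimage, s2_s2]
      exact hadj.2.2.1
    · have := hadj.2.2.2 t ht ht'
      simpa [LinInv.s2] using this

theorem exists_point (c : Letter A) : ∃ z, z ∈ L.Ia c :=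
  ⟨((L.endLo c + L.endHi c) / 2, L.comp c),
    mem_Ia.2 ⟨⟨by simp only; linarith [L.end_lt c], by simp only; linarith [L.end_lt c]⟩, rfl⟩⟩

/-- Minimality, up to the mixing of the components in the nonorientable case. -/
theorem Inv.mem_of_mem' (hnc : ¬ L.HasConnection) (hfin : L.Sig.Finite) (hne : L.Sig.Nonempty)
    {W : Set (ℝ × Bool)} (hWo : IsOpen W) (hWI : W ⊆ L.Ihat) (hW : L.Inv W) {q q' : ℝ × Bool}
    (hq : q ∈ W) (hq' : q' ∈ L.Ihat) (he : q'.2 = q.2 ∨ L.Nonorientable) : q' ∈ W := by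
  rcases Bool.eq_or_eq_not q'.2 q.2 with h | h
  · exact hW.mem_of_mem hnc hfin hne hWo hWI hq hq' h
  obtain ⟨c, hc⟩ := he.resolve_left (by rw [h]; simp)
  obtain ⟨z, hz⟩ := L.exists_point c
  have hzI := mem_Ihat_of_mem_Ia hz
  have hzS := notMem_Sig_of_mem_Ia hz
  have hz2 := (mem_Ia.1 hz).2
  have hT2 : (L.T z).2 = !z.2 := by rw [T_snd hz, hz2, hc]
  have hTW : z ∈ W ∧ L.T z ∈ W := by
    rw [← hW z hzI hzS, and_self]
    rcases Bool.eq_or_eq_not z.2 q.2 with h' | h'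
    · exact hW.mem_of_mem hnc hfin hne hWo hWI hq hzI h'
    · rw [hW z hzI hzS]
      exact hW.mem_of_mem hnc hfin hne hWo hWI hq (T_mem_Ihat hzI hzS) (by simp [hT2, h'])
  rcases Bool.eq_or_eq_not q'.2 z.2 with h' | h'
  · exact hW.mem_of_mem hnc hfin hne hWo hWI hTW.1 hq' h'
  · exact hW.mem_of_mem hnc hfin hne hWo hWI hTW.2 hq' (by rw [h', hT2])

theorem Reg.snd_eq (ho : ¬ L.Nonorientable) {n : ℕ} : ∀ {z : ℝ × Bool}, L.Reg n z →
    ((L.T)^[n] z).2 = z.2 := by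
  induction n with
  | zero => intro z _; rfl
  | succ n ih =>
    intro z hz
    rw [reg_succ] at hz
    rw [Function.iterate_succ_apply, ih hz.2.2]
    obtain ⟨c, hc⟩ := exists_mem_Ia hz.1 hz.2.1
    rw [T_snd hc, (mem_Ia.1 hc).2]
    have : L.comp c ≠ L.comp (Letter.inv c) := fun h => ho ⟨c, h⟩
    exact (Bool.eq_not_of_ne this).symm

theorem T_fst_or {c : Letter A} {z : ℝ × Bool} (hz : z ∈ L.Ia c) :
    (L.T z).1 - L.endLo (Letter.inv c) = z.1 - L.endLo c ∨
      (L.T z).1 - L.endLo (Letter.inv c) = L.endHi c - z.1 := by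
  obtain ⟨s, α, hs, hT⟩ := L.exists_T_eq c
  have hlen := L.len_inv c
  have hmap : ∀ x, L.endLo c < x → x < L.endHi c →
      L.endLo (Letter.inv c) < s * x + α ∧ s * x + α < L.endHi (Letter.inv c) := by
    intro x h1 h2
    have h3 : ((x, L.comp c) : ℝ × Bool) ∈ L.Ia c := mem_Ia.2 ⟨⟨h1, h2⟩, rfl⟩
    have h4 := (mem_Ia.1 (s2_T_mem_Ia h3)).1
    rw [hT _ h3] at h4
    exact h4
  rw [hT z hz]
  have hlt := L.end_lt c
  rcases hs with rfl | rfl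
  · left
    have h1 : L.endLo (Letter.inv c) - α ≤ L.endLo c := by
      refine le_of_forall_gt_imp_ge_of_dense fun x hx => ?_
      rcases lt_or_ge x (L.endHi c) with h | h
      · linarith [(hmap x hx h).1]
      · linarith [(hmap ((L.endLo c + L.endHi c) / 2) (by linarith) (by linarith)).1]
    have h2 : L.endHi c ≤ L.endHi (Letter.inv c) - α := by
      refine le_of_forall_lt_imp_le_of_dense fun x hx => ?_
      rcases lt_or_ge (L.endLo c) x with h | h
      · linarith [(hmap x h hx).2]
      · linarith [(hmap ((L.endLo c + L.endHi c) / 2) (by linarith) (by linarith)).2]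
    simp only
    linarith
  · right
    have h1 : α - L.endHi (Letter.inv c) ≤ L.endLo c := by
      refine le_of_forall_gt_imp_ge_of_dense fun x hx => ?_
      rcases lt_or_ge x (L.endHi c) with h | h
      · linarith [(hmap x hx h).2]
      · linarith [(hmap ((L.endLo c + L.endHi c) / 2) (by linarith) (by linarith)).2]
    have h2 : L.endHi c ≤ α - L.endLo (Letter.inv c) := by
      refine le_of_forall_lt_imp_le_of_dense fun x hx => ?_
      rcases lt_or_ge (L.endLo c) x with h | h
      · linarith [(hmap x h hx).1]
      · linarith [(hmap ((L.endLo c + L.endHi c) / 2) (by linarith) (by linarith)).1]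
    simp only
    linarith

theorem exists_margin (hfin : L.Sig.Finite) : ∃ ε > 0,
    (∀ c, 2 * ε ≤ L.endHi c - L.endLo c) ∧
    (∀ σ ∈ L.Sig, ε ≤ σ.1 - L.lo ∧ ε ≤ L.hi - σ.1) := by
  have h1 : ∀ᶠ ε in 𝓝[>] (0 : ℝ), ∀ c, 2 * ε ≤ L.endHi c - L.endLo c := by
    rw [eventually_all]
    intro c
    have : (0 : ℝ) < (L.endHi c - L.endLo c) / 2 := by linarith [L.end_lt c]
    filter_upwards [Ioc_mem_nhdsGT this] with ε hε
    linarith [hε.2]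
  have h2 : ∀ᶠ ε in 𝓝[>] (0 : ℝ), ∀ σ ∈ L.Sig, ε ≤ σ.1 - L.lo ∧ ε ≤ L.hi - σ.1 := by
    rw [eventually_all_finite hfin]
    intro σ hσ
    have h := mem_Ihat.1 (L.Sig_sub hσ)
    have : (0 : ℝ) < min (σ.1 - L.lo) (L.hi - σ.1) :=
      lt_min (by linarith [h.1]) (by linarith [h.2])
    filter_upwards [Ioc_mem_nhdsGT this] with ε hε
    exact le_min_iff.1 hε.2
  obtain ⟨ε, hlen, hSig, h0⟩ := (h1.and (h2.and self_mem_nhdsWithin)).exists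
  exact ⟨ε, h0, hlen, hSig⟩

/-- Near the ends of `I`, the map `T` preserves the distance to the ends. -/
theorem T_near_end {ε : ℝ} (hlen : ∀ c, 2 * ε ≤ L.endHi c - L.endLo c)
    (hS : ∀ σ ∈ L.Sig, ε ≤ σ.1 - L.lo ∧ ε ≤ L.hi - σ.1) {z : ℝ × Bool} (hz : z ∈ L.Ihat)
    (hz' : z ∉ L.Sig) {r r' : ℝ} (hr : r < ε) (hr' : r' < ε)
    (h : z.1 = L.lo + r ∨ z.1 = L.hi - r) (h' : (L.T z).1 = L.lo + r' ∨ (L.T z).1 = L.hi - r') :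
    (L.T z).1 = L.lo + r ∨ (L.T z).1 = L.hi - r := by
  have key : ∀ (c : Letter A) (x r : ℝ), r < ε → L.endLo c < x → x < L.endHi c →
      (x = L.lo + r ∨ x = L.hi - r) →
      (x = L.lo + r ∧ L.endLo c = L.lo) ∨ (x = L.hi - r ∧ L.endHi c = L.hi) := by
    intro c x r hr h1 h2 h
    refine h.imp (fun h => ⟨h, ?_⟩) (fun h => ⟨h, ?_⟩)
    · by_contra hne
      linarith [(hS _ (left_end_mem_Sig (lt_of_le_of_ne (L.sub_lo c) (Ne.symm hne)))).1]
    · by_contra hne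
      linarith [(hS _ (right_end_mem_Sig (lt_of_le_of_ne (L.sub_hi c) hne))).2]
  obtain ⟨c, hc⟩ := exists_mem_Ia hz hz'
  have h1 := mem_Ia.1 hc
  have h2 : _ ∧ _ := (mem_Ia.1 (s2_T_mem_Ia hc)).1
  have h3 := T_fst_or hc
  have h4 := L.len_inv c
  have h5 := hlen c
  have h6 := key c _ _ hr h1.1.1 h1.1.2 h
  have h7 := key (Letter.inv c) (L.T z).1 _ hr' h2.1 h2.2 h'
  rcases h7 with h7 | h7
  · left
    rcases h6 with h6 | h6 <;> rcases h3 with h3 | h3 <;> linarith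
  · right
    rcases h6 with h6 | h6 <;> rcases h3 with h3 | h3 <;> linarith

variable (L) in
/-- The points which are not accumulated by the orbit of `p`. -/
def Wand (p : ℝ × Bool) : Set (ℝ × Bool) :=
  {z | z ∈ L.Ihat ∧ ∃ N, ∀ᶠ q in 𝓝 z, ∀ n ≥ N, (L.T)^[n] p ≠ q}

theorem isOpen_wand (p : ℝ × Bool) : IsOpen (L.Wand p) := by
  rw [isOpen_iff_mem_nhds]
  rintro z ⟨hz, N, h⟩
  filter_upwards [L.isOpen_Ihat.mem_nhds hz, eventually_eventually_nhds.2 h] with q h1 h2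
  exact ⟨h1, N, h2⟩

theorem FwdInf.inv_wand {p : ℝ × Bool} (hp : L.FwdInf p) : L.Inv (L.Wand p) := by
  intro z hz hz'
  have hT := T_mem_Ihat hz hz'
  simp only [Wand, mem_ofPred_eq, hz, hT, true_and, eventually_T hz hz']
  constructor
  · rintro ⟨N, h⟩
    refine ⟨N + 1, ?_⟩
    filter_upwards [h, eventually_regular hz hz'] with q h1 h2 n hn he
    obtain ⟨m, rfl⟩ : ∃ m, n = m + 1 := ⟨n - 1, by omega⟩
    rw [Function.iterate_succ_apply'] at he
    exact h1 m (by omega) (T_inj (hp.iterate m).1 (hp.2 m) h2.1 h2.2 he)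
  · rintro ⟨N, h⟩
    refine ⟨N, ?_⟩
    filter_upwards [h] with q h1 n hn he
    exact h1 (n + 1) (by omega) (by rw [Function.iterate_succ_apply', he])

theorem FwdInf.exists_notMem_wand (hnc : ¬ L.HasConnection) (hfin : L.Sig.Finite)
    (hne : L.Sig.Nonempty) {p : ℝ × Bool} (hp : L.FwdInf p) : ∃ z ∈ L.Ihat, z ∉ L.Wand p := by
  by_contra! hcon
  obtain ⟨ε, hε, hlen, hS⟩ := L.exists_margin hfin
  set K : Set (ℝ × Bool) := Icc (L.lo + ε) (L.hi - ε) ×ˢ (univ : Set Bool) with hK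
  have hKc : IsCompact K := isCompact_Icc.prod isCompact_univ
  obtain ⟨N, hN⟩ : ∃ N, ∀ n ≥ N, (L.T)^[n] p ∉ K := by
    refine hKc.induction_on (p := fun S => ∃ N, ∀ n ≥ N, (L.T)^[n] p ∉ S) ⟨0, by simp⟩ ?_ ?_ ?_
    · rintro s t hst ⟨N, h⟩
      exact ⟨N, fun n hn h' => h n hn (hst h')⟩
    · rintro s t ⟨N, h⟩ ⟨M, h'⟩
      refine ⟨max N M, fun n hn h'' => ?_⟩
      rcases h'' with h'' | h''
      · exact h n ((le_max_left _ _).trans hn) h''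
      · exact h' n ((le_max_right _ _).trans hn) h''
    · intro x hx
      obtain ⟨-, N, h⟩ := hcon x (mem_Ihat.2 ⟨by linarith [hx.1.1], by linarith [hx.1.2]⟩)
      exact ⟨_, mem_nhdsWithin_of_mem_nhds h, N, fun n hn h' => h' n hn rfl⟩
  have hnear : ∀ n ≥ N, ∃ r < ε, ((L.T)^[n] p).1 = L.lo + r ∨ ((L.T)^[n] p).1 = L.hi - r := by
    intro n hn
    have h1 : ¬ _ := fun h => hN n hn ⟨h, mem_univ _⟩
    rw [mem_Icc, not_and_or, not_le, not_le] at h1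
    rcases h1 with h1 | h1
    · exact ⟨((L.T)^[n] p).1 - L.lo, by linarith, Or.inl (by ring)⟩
    · exact ⟨L.hi - ((L.T)^[n] p).1, by linarith, Or.inr (by ring)⟩
  obtain ⟨r, hr, h0⟩ := hnear N le_rfl
  have hall : ∀ m, ((L.T)^[m + N] p).1 = L.lo + r ∨ ((L.T)^[m + N] p).1 = L.hi - r := by
    intro m
    induction m with
    | zero => simpa using h0
    | succ m ih =>
      obtain ⟨r', hr', h'⟩ := hnear (m + 1 + N) (by omega)
      rw [show m + 1 + N = m + N + 1 by omega, Function.iterate_succ_apply'] at h' ⊢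
      exact T_near_end hlen hS (hp.iterate _).1 (hp.2 _) hr hr' ih h'
  have hF : (({L.lo + r, L.hi - r} : Set ℝ) ×ˢ (univ : Set Bool)).Finite :=
    (Set.toFinite _).prod (Set.toFinite _)
  refine Set.infinite_of_injective_forall_mem (f := fun m => (L.T)^[m + N] p) ?_
    (fun m => ?_) hF
  · intro i j h
    have := hp.iterate_injective hnc hne h
    omega
  · exact ⟨by simpa using hall m, mem_univ _⟩

/-- Recurrence: every infinite forward orbit is dense in the components it can reach. -/
theorem FwdInf.frequently_mem (hnc : ¬ L.HasConnection) (hfin : L.Sig.Finite)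
    (hne : L.Sig.Nonempty) {p q : ℝ × Bool} (hp : L.FwdInf p) (hq : q ∈ L.Ihat)
    (h : q.2 = p.2 ∨ L.Nonorientable) {U : Set (ℝ × Bool)} (hU : U ∈ 𝓝 q) (N : ℕ) :
    ∃ n ≥ N, (L.T)^[n] p ∈ U := by
  by_contra! hcon
  have hqW : q ∈ L.Wand p := ⟨hq, N, by
    filter_upwards [hU] with q' h' n hn he
    exact hcon n hn (he ▸ h')⟩
  obtain ⟨v, hv, hvW⟩ := hp.exists_notMem_wand hnc hfin hne
  refine hvW (hp.inv_wand.mem_of_mem' hnc hfin hne (isOpen_wand p) (fun z hz => hz.1) hqW hv ?_)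
  refine (em L.Nonorientable).symm.imp (fun ho => ?_) id
  rw [h.resolve_right ho]
  by_contra hne'
  refine hvW ⟨hv, 0, ?_⟩
  filter_upwards [eventually_snd_eq v] with q' h' n _ he
  rw [← he, (hp.reg n).snd_eq ho] at h'
  exact hne' h'.symm

variable (L) in
/-- The points whose two half-orbits are infinite. -/
def Z : Set (ℝ × Bool) := L.Ihat \ L.Ohat

theorem fwdInf_iff {z : ℝ × Bool} : L.FwdInf z ↔ z ∈ L.Ihat ∧ z ∉ L.O := by
  simp [FwdInf, O]

theorem mem_Z {z : ℝ × Bool} : z ∈ L.Z ↔ L.FwdInf z ∧ L.FwdInf (s2 z) := by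
  have h : z ∈ s2 '' L.O ↔ s2 z ∈ L.O :=
    ⟨by rintro ⟨q, hq, rfl⟩; simpa using hq, fun h => ⟨_, h, s2_s2 z⟩⟩
  rw [fwdInf_iff, fwdInf_iff, s2_mem_Ihat, Z, Ohat, Set.mem_sdiff, mem_union, h]
  tauto

theorem FwdInf.of_T {z : ℝ × Bool} (h : z ∈ L.Ihat) (h' : z ∉ L.Sig) (hT : L.FwdInf (L.T z)) :
    L.FwdInf z :=
  ⟨h, fun j => by
    cases j with
    | zero => exact h'
    | succ j => exact hT.2 j⟩

theorem T_mem_Z {z : ℝ × Bool} (h : z ∈ L.Z) : L.T z ∈ L.Z := by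
  rw [mem_Z] at h ⊢
  have h0 := h.1.2 0
  refine ⟨h.1.iterate 1, FwdInf.of_T (s2_mem_Ihat.2 (T_mem_Ihat h.1.1 h0))
    (s2_T_notMem_Sig h.1.1 h0) ?_⟩
  rw [T_s2_T h.1.1 h0]
  exact h.2

theorem mem_Z_of_T {z : ℝ × Bool} (h : z ∈ L.Ihat) (h' : z ∉ L.Sig) (hT : L.T z ∈ L.Z) :
    z ∈ L.Z := by
  rw [mem_Z] at hT ⊢
  refine ⟨FwdInf.of_T h h' hT.1, ?_⟩
  have := hT.2.iterate 1
  rwa [Function.iterate_one, T_s2_T h h'] at this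

theorem iterate_mem_Z {z : ℝ × Bool} (h : z ∈ L.Z) (n : ℕ) : (L.T)^[n] z ∈ L.Z := by
  induction n with
  | zero => exact h
  | succ n ih => rw [Function.iterate_succ_apply']; exact T_mem_Z ih

theorem countable_not_fwdInf (hfin : L.Sig.Finite) :
    {z | z ∈ L.Ihat ∧ ¬ L.FwdInf z}.Countable := by
  have h : {z | z ∈ L.Ihat ∧ ¬ L.FwdInf z} ⊆
      ⋃ n : ℕ, {z | L.Reg n z ∧ (L.T)^[n] z ∈ L.Sig} := by
    rintro z ⟨h1, h2⟩
    obtain ⟨n, hn⟩ := exists_first_Sig h1 h2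
    exact mem_iUnion.2 ⟨n, hn⟩
  refine (countable_iUnion fun n => ?_).mono h
  exact MapsTo.countable_of_injOn (f := (L.T)^[n]) (t := L.Sig) (fun z hz => hz.2)
    (fun z hz z' hz' e => hz.1.inj hz'.1 e) hfin.countable

theorem exists_mem_Z (hfin : L.Sig.Finite) {z : ℝ × Bool} (hz : z ∈ L.Ihat)
    {U : Set (ℝ × Bool)} (hU : U ∈ 𝓝 z) : ∃ q ∈ L.Z, q ∈ U := by
  have h1 := L.countable_not_fwdInf hfin
  have h2 : (s2 ⁻¹' {z | z ∈ L.Ihat ∧ ¬ L.FwdInf z}).Countable :=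
    h1.preimage (Function.LeftInverse.injective (g := s2) s2_s2)
  obtain ⟨x, δ⟩ := z
  have h3 := (((h1.union h2).preimage (f := fun y : ℝ => (y, δ))
    (fun a b h => (Prod.ext_iff.1 h).1)).dense_compl ℝ).inter_nhds_nonempty (x := x)
    (t := {y | (y, δ) ∈ L.Ihat ∩ U})
    (eventually_nhds_prod_bool.1 (inter_mem (L.isOpen_Ihat.mem_nhds hz) hU))
  obtain ⟨y, hy, hyI, hyU⟩ := h3
  refine ⟨(y, δ), mem_Z.2 ?_, hyU⟩
  simp only [mem_compl_iff, mem_preimage, mem_union, mem_ofPred_eq, s2_mem_Ihat, hyI, true_and,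
    not_or, not_not] at hy
  exact hy

variable (L) in
/-- The letter of the interval containing `z`. -/
noncomputable def letter [Nonempty A] (z : ℝ × Bool) : Letter A :=
  Classical.epsilon fun c => z ∈ L.Ia c

theorem letter_eq [Nonempty A] {z : ℝ × Bool} {c : Letter A} (h : z ∈ L.Ia c) :
    L.letter z = c :=
  eq_of_mem_Ia (Classical.epsilon_spec (p := fun c => z ∈ L.Ia c) ⟨c, h⟩) h

variable (L) in
/-- The word of length `n` coding the orbit of `z`. -/
noncomputable def cod [Nonempty A] : ℕ → ℝ × Bool → List (Letter A)
  | 0, _ => []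
  | n + 1, z => L.letter z :: cod n (L.T z)

variable (L) in
/-- The orbit of `z` follows the word `u`. -/
def Fol : List (Letter A) → ℝ × Bool → Prop
  | [], _ => True
  | c :: u, z => z ∈ L.Ia c ∧ Fol u (L.T z)

@[simp] theorem length_cod [Nonempty A] (n : ℕ) : ∀ z, (L.cod n z).length = n := by
  induction n with
  | zero => intro z; rfl
  | succ n ih => intro z; simp [cod, ih]

theorem cod_add [Nonempty A] (m n : ℕ) : ∀ z,
    L.cod (m + n) z = L.cod m z ++ L.cod n ((L.T)^[m] z) := by
  induction m with
  | zero => intro z; simp [cod]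
  | succ m ih => intro z; rw [show m + 1 + n = (m + n) + 1 by ring]; simp [cod, ih]

theorem fol_append {u v : List (Letter A)} : ∀ {z : ℝ × Bool},
    L.Fol (u ++ v) z ↔ L.Fol u z ∧ L.Fol v ((L.T)^[u.length] z) := by
  induction u with
  | nil => intro z; simp [Fol]
  | cons c u ih => intro z; simp [Fol, ih, and_assoc]

theorem Fol.reg {u : List (Letter A)} : ∀ {z : ℝ × Bool}, L.Fol u z → z ∈ L.Ihat →
    L.Reg u.length z := by
  induction u with
  | nil => intro z _ h; exact ⟨h, by simp⟩
  | cons c u ih =>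
    intro z h hz
    rw [List.length_cons, reg_succ]
    have h' := notMem_Sig_of_mem_Ia h.1
    exact ⟨hz, h', ih h.2 (T_mem_Ihat hz h')⟩

theorem Fol.cod_eq [Nonempty A] {u : List (Letter A)} : ∀ {z : ℝ × Bool}, L.Fol u z →
    L.cod u.length z = u := by
  induction u with
  | nil => intro z _; rfl
  | cons c u ih => intro z h; simp [cod, letter_eq h.1, ih h.2]

theorem Reg.fol_cod [Nonempty A] {n : ℕ} : ∀ {z : ℝ × Bool}, L.Reg n z →
    L.Fol (L.cod n z) z := by
  induction n with
  | zero => intro z _; trivial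
  | succ n ih =>
    intro z h
    rw [reg_succ] at h
    obtain ⟨c, hc⟩ := exists_mem_Ia h.1 h.2.1
    refine ⟨?_, ih h.2.2⟩
    rwa [letter_eq hc]

theorem Fol.eventually {u : List (Letter A)} : ∀ {z : ℝ × Bool}, L.Fol u z →
    ∀ᶠ q in 𝓝 z, L.Fol u q := by
  induction u with
  | nil => intro z _; exact Eventually.of_forall fun _ => trivial
  | cons c u ih =>
    intro z h
    filter_upwards [(L.isOpen_Ia c).mem_nhds h.1, (eventually_T (mem_Ihat_of_mem_Ia h.1)
      (notMem_Sig_of_mem_Ia h.1)).1 (ih h.2)] with q h1 h2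
    exact ⟨h1, h2⟩

theorem Reg.eventually_cod_eq [Nonempty A] {n : ℕ} {z : ℝ × Bool} (h : L.Reg n z) :
    ∀ᶠ q in 𝓝 z, L.cod n q = L.cod n z := by
  filter_upwards [h.fol_cod.eventually] with q hq
  simpa using hq.cod_eq

theorem Reg.fol_iff [Nonempty A] {u : List (Letter A)} {z : ℝ × Bool} (h : L.Reg u.length z) :
    L.Fol u z ↔ L.cod u.length z = u :=
  ⟨fun h' => h'.cod_eq, fun h' => h' ▸ h.fol_cod⟩

theorem isCodingFrom_iff {u : List (Letter A)} : ∀ {z : ℝ × Bool} {m : ℕ},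
    L.IsCodingFrom z m u ↔ L.Fol u ((L.T)^[m] z) := by
  induction u with
  | nil => intro z m; simp [IsCodingFrom, Fol]
  | cons c u ih =>
    intro z m
    have h : L.Fol u (L.T ((L.T)^[m] z)) ↔ L.IsCodingFrom z (m + 1) u := by
      rw [ih, Function.iterate_succ_apply']
    rw [Fol, h]
    change (∀ i : Fin (u.length + 1), _) ↔ _
    rw [Fin.forall_fin_succ]
    refine and_congr (by simp) (forall_congr' fun i => ?_)
    rw [show m + (i.succ : Fin (u.length + 1)).1 = m + 1 + i.1 by simp; ring]
    simp

theorem mem_lang {u : List (Letter A)} : u ∈ L.lang ↔ ∃ z ∈ L.Z, L.Fol u z := by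
  constructor
  · rintro ⟨z, hz, m, h⟩
    exact ⟨_, iterate_mem_Z hz m, isCodingFrom_iff.1 h⟩
  · rintro ⟨z, hz, h⟩
    exact ⟨z, hz, 0, isCodingFrom_iff.2 h⟩

theorem Fol.path {u : List (Letter A)} : ∀ {z : ℝ × Bool}, L.Fol u z →
    L.Path z.2 u ((L.T)^[u.length] z).2 := by
  induction u with
  | nil => intro z _; rfl
  | cons c u ih =>
    intro z h
    refine ⟨(mem_Ia.1 h.1).2.symm, ?_⟩
    have := ih h.2
    rwa [T_snd h.1] at this

theorem Path.right_unique {u : List (Letter A)} : ∀ {δ ε ε' : Bool}, L.Path δ u ε →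
    L.Path δ u ε' → ε = ε' := by
  induction u with
  | nil => intro δ ε ε' h h'; exact h.symm.trans h'
  | cons c u ih => intro δ ε ε' h h'; exact ih h.2 h'.2

theorem Path.left_unique {u : List (Letter A)} (hu : u ≠ []) {δ δ' ε ε' : Bool}
    (h : L.Path δ u ε) (h' : L.Path δ' u ε') : δ = δ' := by
  cases u with
  | nil => exact absurd rfl hu
  | cons c u => exact h.1.symm.trans h'.1

theorem Fol.ordConnected {u : List (Letter A)} : ∀ {δ : Bool} {x y z : ℝ}, x ≤ y → y ≤ z →
    L.Fol u (x, δ) → L.Fol u (z, δ) → L.Fol u (y, δ) := by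
  induction u with
  | nil => intros; trivial
  | cons c u ih =>
    intro δ x y z hxy hyz hx hz
    have h1 := mem_Ia.1 hx.1
    have h2 := mem_Ia.1 hz.1
    have h3 : ((y, δ) : ℝ × Bool) ∈ L.Ia c :=
      mem_Ia.2 ⟨⟨h1.1.1.trans_le hxy, hyz.trans_lt h2.1.2⟩, h1.2⟩
    refine ⟨h3, ?_⟩
    obtain ⟨s, α, hs, hT⟩ := L.exists_T_eq c
    have hx' := hx.2
    have hz' := hz.2
    rw [hT _ hx.1] at hx'
    rw [hT _ hz.1] at hz'
    rw [hT _ h3]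
    rcases hs with rfl | rfl
    · exact ih (by simp only; linarith) (by simp only; linarith) hx' hz'
    · exact ih (by simp only; linarith) (by simp only; linarith) hz' hx'

variable (L) in
/-- The orbit of `z` starts with `w` and first follows `w` again after `n` steps. -/
def Ret (w : List (Letter A)) (z : ℝ × Bool) (n : ℕ) : Prop :=
  L.Fol w z ∧ 0 < n ∧ L.Fol w ((L.T)^[n] z) ∧ ∀ i, 0 < i → i < n → ¬ L.Fol w ((L.T)^[i] z)

theorem cod_append_eq [Nonempty A] {w : List (Letter A)} {z : ℝ × Bool} {n : ℕ} (h : L.Fol w z)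
    (h' : L.Fol w ((L.T)^[n] z)) :
    L.cod n z ++ w = w ++ L.cod n ((L.T)^[w.length] z) := by
  have h1 := cod_add (L := L) n w.length z
  rw [h'.cod_eq, Nat.add_comm, cod_add, h.cod_eq] at h1
  exact h1.symm

theorem mem_rightReturn [Nonempty A] {w u : List (Letter A)} :
    u ∈ RightReturn L.lang w ↔
      ∃ z ∈ L.Z, ∃ n, L.Ret w z n ∧ u = L.cod n ((L.T)^[w.length] z) := by
  simp only [RightReturn, CompleteFirstReturnWord, CompleteReturnWord, mem_ofPred_eq,
    mem_singleton_iff, exists_eq_left, mem_lang]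
  constructor
  · rintro ⟨⟨⟨z, hz, hf⟩, ⟨-, hu⟩, ⟨⟨t, ht⟩, -⟩⟩, hno⟩
    have hf' := fol_append.1 hf
    have hlen : t.length = u.length := by
      have := congrArg List.length ht
      simp only [List.length_append] at this
      omega
    have hu0 : u ≠ [] := by
      rintro rfl
      simp at hu
    have ht' : L.Fol w ((L.T)^[u.length] z) := by
      rw [← ht, fol_append, hlen] at hf
      exact hf.2
    refine ⟨z, hz, u.length, ⟨hf'.1, List.length_pos_iff.2 hu0, ht', fun i h1 h2 h3 => hno ?_⟩,
      hf'.2.cod_eq.symm⟩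
    refine ⟨L.cod i z, w, L.cod (u.length - i) ((L.T)^[w.length] ((L.T)^[i] z)), ?_, rfl, ?_, ?_⟩
    · have h4 := hf.cod_eq
      rw [List.length_append, show w.length + u.length = i + (w.length + (u.length - i)) by omega,
        cod_add, cod_add, h3.cod_eq] at h4
      rw [← h4, List.append_assoc]
    · rw [← List.length_pos_iff, length_cod]
      exact h1
    · rw [← List.length_pos_iff, length_cod]
      omega
  · rintro ⟨z, hz, n, ⟨h1, h2, h3, h4⟩, rfl⟩
    have h5 := cod_append_eq h1 h3
    have h6 : L.Fol (w ++ L.cod n ((L.T)^[w.length] z)) z :=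
      fol_append.2 ⟨h1, (((mem_Z.1 (iterate_mem_Z hz w.length)).1).reg n).fol_cod⟩
    have h7 : w ≠ w ++ L.cod n ((L.T)^[w.length] z) := by
      intro h
      have := congrArg List.length h
      simp only [List.length_append, length_cod] at this
      omega
    refine ⟨⟨⟨z, hz, h6⟩, ⟨List.prefix_append _ _, h7⟩, ⟨⟨_, h5⟩, h7⟩⟩, ?_⟩
    rintro ⟨p, v, s, he, rfl, hp, hs⟩
    have hlen := congrArg List.length he
    simp only [List.length_append, length_cod] at hlen
    have hs' := List.length_pos_iff.2 hs
    rw [he, List.append_assoc, fol_append, fol_append] at h6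
    exact h4 p.length (List.length_pos_iff.2 hp) (by omega) h6.2.1

end LinearInvolution

/-- A function which is locally constant along a dense set is constant on connected open sets. -/
theorem eq_of_locally_const {X Y : Type*} [TopologicalSpace X] {J D : Set X} {g : X → Y}
    (hJ : IsPreconnected J) (hJo : IsOpen J) (hd : ∀ x ∈ J, ∀ V ∈ 𝓝 x, ∃ x' ∈ D, x' ∈ V)
    (hloc : ∀ x ∈ J, ∃ y, ∀ᶠ x' in 𝓝 x, x' ∈ D → g x' = y) {z z' : X} (hz : z ∈ J) (hzD : z ∈ D)
    (hz' : z' ∈ J) (hzD' : z' ∈ D) : g z' = g z := by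
  set V : Set X := {q | ∀ᶠ q' in 𝓝 q, q' ∈ D → g q' = g z} with hV
  have hVo : IsOpen V := by
    rw [isOpen_iff_mem_nhds]
    exact fun q hq => eventually_eventually_nhds.2 hq
  have hzV : z ∈ V := by
    obtain ⟨y, hy⟩ := hloc z hz
    have := hy.self_of_nhds hzD
    subst this
    exact hy
  have hsub : J ⊆ V := by
    refine hJ.subset_of_closure_inter_subset hVo ⟨z, hz, hzV⟩ ?_
    rintro q ⟨hqV, hqJ⟩
    obtain ⟨y, hy⟩ := hloc q hqJ
    obtain ⟨q₁, h1, h2, h3⟩ := ((mem_closure_iff_frequently.1 hqV).and_eventually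
      ((eventually_eventually_nhds.2 hy).and (hJo.mem_nhds hqJ))).exists
    obtain ⟨q₂, h4, h5, h6⟩ := hd q₁ h3 _ (inter_mem h1 h2)
    have : g z = y := (h5 h4).symm.trans (h6 h4)
    subst this
    exact hy
  exact Eventually.self_of_nhds (hsub hz') hzD'

namespace LinearInvolution

variable {A : Type*} [Fintype A] {L : LinearInvolution A}

theorem snd_eq_or_iff {δ : Bool} {z : ℝ × Bool} (hz : z ∈ L.Ihat) (hz' : z ∉ L.Sig) :
    ((L.T z).2 = δ ∨ L.Nonorientable) ↔ (z.2 = δ ∨ L.Nonorientable) := by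
  by_cases h : L.Nonorientable
  · simp [h]
  · have : L.Reg 1 z := reg_succ.2 ⟨hz, hz', T_mem_Ihat hz hz', by simp⟩
    have := this.snd_eq h
    rw [Function.iterate_one] at this
    rw [this]

/-- A function on orbits which is compatible with the action of letters and locally constant
somewhere is constant on components. -/
theorem exists_eq_comp_snd (hnc : ¬ L.HasConnection) (hfin : L.Sig.Finite) (hne : L.Sig.Nonempty)
    {Y : Type*} (K : ℝ × Bool → Y) (θ : Letter A → Equiv.Perm Y) (δ : Bool)
    (hθ : ∀ z ∈ L.Z, (z.2 = δ ∨ L.Nonorientable) → ∀ c, z ∈ L.Ia c → K z = θ c (K (L.T z)))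
    {z₀ : ℝ × Bool} (hz₀ : z₀ ∈ L.Ihat) (hδ : z₀.2 = δ) (y₀ : Y)
    (h₀ : ∀ᶠ q in 𝓝 z₀, q ∈ L.Z → K q = y₀) :
    ∃ k : Bool → Y, ∀ z ∈ L.Z, (z.2 = δ ∨ L.Nonorientable) → K z = k z.2 := by
  set W : Set (ℝ × Bool) := {q | q ∈ L.Ihat ∧ (q.2 = δ ∨ L.Nonorientable) ∧
    ∃ y, ∀ᶠ q' in 𝓝 q, q' ∈ L.Z → K q' = y} with hW
  have hWo : IsOpen W := by
    rw [isOpen_iff_mem_nhds]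
    rintro q ⟨h1, h2, y, h3⟩
    filter_upwards [L.isOpen_Ihat.mem_nhds h1, eventually_eventually_nhds.2 h3,
      eventually_snd_eq q] with q' h4 h5 h6
    exact ⟨h4, by rwa [h6], y, h5⟩
  have hWinv : L.Inv W := by
    intro z hz hz'
    obtain ⟨c, hc⟩ := exists_mem_Ia hz hz'
    simp only [hW, mem_ofPred_eq, hz, T_mem_Ihat hz hz', true_and, snd_eq_or_iff hz hz',
      eventually_T hz hz']
    refine and_congr_right fun hg => ⟨?_, ?_⟩
    · rintro ⟨y, hy⟩
      refine ⟨(θ c)⁻¹ y, ?_⟩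
      filter_upwards [hy, (L.isOpen_Ia c).mem_nhds hc, eventually_snd_eq z] with q h1 h2 h3 h4
      have h5 := mem_Z_of_T (mem_Ihat_of_mem_Ia h2) (notMem_Sig_of_mem_Ia h2) h4
      rw [← h1 h5, hθ q h5 (by rwa [h3]) c h2]
      simp
    · rintro ⟨y, hy⟩
      refine ⟨θ c y, ?_⟩
      filter_upwards [hy, (L.isOpen_Ia c).mem_nhds hc, eventually_snd_eq z] with q h1 h2 h3 h4
      rw [hθ q h4 (by rwa [h3]) c h2, h1 (T_mem_Z h4)]
  have hz₀W : z₀ ∈ W := ⟨hz₀, Or.inl hδ, y₀, h₀⟩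
  have hall : ∀ q ∈ L.Ihat, (q.2 = δ ∨ L.Nonorientable) → q ∈ W := fun q hq hg =>
    hWinv.mem_of_mem' hnc hfin hne hWo (fun z hz => hz.1) hz₀W hq (by rwa [hδ])
  have hpt : ∀ ε : Bool, ∃ z ∈ L.Z, z.2 = ε := by
    intro ε
    have h1 : ((L.lo + L.hi) / 2, ε) ∈ L.Ihat :=
      mem_Ihat.2 ⟨by simp only; linarith [L.lo_lt_hi], by simp only; linarith [L.lo_lt_hi]⟩
    exact exists_mem_Z hfin h1 (eventually_snd_eq _)
  choose p hpZ hp2 using hpt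
  refine ⟨fun ε => K (p ε), fun z hz hg => ?_⟩
  refine eq_of_locally_const (J := Ioo L.lo L.hi ×ˢ ({z.2} : Set Bool)) (D := L.Z)
    (isPreconnected_component _) (isOpen_Ioo.prod (isOpen_discrete _)) ?_ ?_
    ⟨(hpZ _).1.1, hp2 _⟩ (hpZ _) ⟨hz.1.1, rfl⟩ hz
  · exact fun x hx V hV => exists_mem_Z hfin ⟨hx.1, mem_univ _⟩ hV
  · intro x hx
    exact (hall x ⟨hx.1, mem_univ _⟩ (by rwa [show x.2 = z.2 from hx.2])).2.2

variable (L) in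
/-- The first time at which the orbit of `z` follows `w`. -/
noncomputable def ent (w : List (Letter A)) (z : ℝ × Bool) : ℕ := sInf {n | L.Fol w ((L.T)^[n] z)}

theorem fol_ent {w : List (Letter A)} {z : ℝ × Bool} (h : ∃ n, L.Fol w ((L.T)^[n] z)) :
    L.Fol w ((L.T)^[L.ent w z] z) :=
  Nat.sInf_mem (s := {n | L.Fol w ((L.T)^[n] z)}) h

theorem not_fol_of_lt_ent {w : List (Letter A)} {z : ℝ × Bool} {n : ℕ} (h : n < L.ent w z) :
    ¬ L.Fol w ((L.T)^[n] z) :=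
  Nat.notMem_of_lt_sInf (s := {n | L.Fol w ((L.T)^[n] z)}) h

theorem ent_eq {w : List (Letter A)} {z : ℝ × Bool} {n : ℕ} (h : L.Fol w ((L.T)^[n] z))
    (h' : ∀ i < n, ¬ L.Fol w ((L.T)^[i] z)) : L.ent w z = n :=
  le_antisymm (Nat.sInf_le h) (not_lt.1 fun hlt => h' _ hlt (fol_ent ⟨n, h⟩))

theorem ent_of_fol {w : List (Letter A)} {z : ℝ × Bool} (h : L.Fol w z) : L.ent w z = 0 :=
  ent_eq h fun i hi => absurd hi (Nat.not_lt_zero i)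

theorem ent_of_not_fol {w : List (Letter A)} {z : ℝ × Bool} (h : ¬ L.Fol w z)
    (h' : ∃ n, L.Fol w ((L.T)^[n] (L.T z))) : L.ent w z = L.ent w (L.T z) + 1 := by
  refine ent_eq ?_ fun i hi => ?_
  · rw [Function.iterate_succ_apply]
    exact fol_ent h'
  · cases i with
    | zero => exact h
    | succ i => exact not_fol_of_lt_ent (z := L.T z) (by omega)

theorem ret_ent {w : List (Letter A)} {z : ℝ × Bool} (h : L.Fol w z)
    (h' : ∃ n, L.Fol w ((L.T)^[n] (L.T z))) : L.Ret w z (L.ent w (L.T z) + 1) := by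
  refine ⟨h, Nat.succ_pos _, ?_, fun i h0 hi => ?_⟩
  · rw [Function.iterate_succ_apply]
    exact fol_ent h'
  · obtain ⟨j, rfl⟩ : ∃ j, i = j + 1 := ⟨i - 1, by omega⟩
    exact not_fol_of_lt_ent (z := L.T z) (by omega)

theorem exists_fol (hnc : ¬ L.HasConnection) (hfin : L.Sig.Finite) (hne : L.Sig.Nonempty)
    {w : List (Letter A)} {z₀ : ℝ × Bool} (hz₀ : z₀ ∈ L.Ihat) (hw : L.Fol w z₀) {z : ℝ × Bool}
    (hz : L.FwdInf z) (hg : z.2 = z₀.2 ∨ L.Nonorientable) : ∃ n, L.Fol w ((L.T)^[n] z) := by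
  obtain ⟨n, -, hn⟩ := hz.frequently_mem hnc hfin hne hz₀ (hg.imp Eq.symm id) hw.eventually 0
  exact ⟨n, hn⟩

/-- Functions of words which are invariant under return words extend to functions of
components which are compatible with the action of letters. -/
theorem exists_transport [Nonempty A] (hnc : ¬ L.HasConnection) (hfin : L.Sig.Finite)
    (hne : L.Sig.Nonempty) {w : List (Letter A)} {z₀ : ℝ × Bool} (hz₀ : z₀ ∈ L.Z)
    (hw : L.Fol w z₀) {Y : Type*} (F : List (Letter A) → Y) (θ : Letter A → Equiv.Perm Y)
    (hF : ∀ c u, F (c :: u) = θ c (F u)) (hR : ∀ u ∈ RightReturn L.lang w, F (w ++ u) = F w) :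
    ∃ k : Bool → Y, k ((L.T)^[w.length] z₀).2 = F [] ∧
      ∀ c, (L.comp c = z₀.2 ∨ L.Nonorientable) →
        k (L.comp c) = θ c (k (!L.comp (Letter.inv c))) := by
  have hex : ∀ z ∈ L.Z, (z.2 = z₀.2 ∨ L.Nonorientable) → ∃ n, L.Fol w ((L.T)^[n] z) :=
    fun z hz hg => exists_fol hnc hfin hne hz₀.1 hw (mem_Z.1 hz).1 hg
  have hexT : ∀ z ∈ L.Z, (z.2 = z₀.2 ∨ L.Nonorientable) →
      ∃ n, L.Fol w ((L.T)^[n] (L.T z)) := fun z hz hg =>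
    hex _ (T_mem_Z hz) ((snd_eq_or_iff hz.1 ((mem_Z.1 hz).1.2 0)).2 hg)
  have hK : ∀ z ∈ L.Z, (z.2 = z₀.2 ∨ L.Nonorientable) → ∀ c, z ∈ L.Ia c →
      F (L.cod (L.ent w z) z ++ w) = θ c (F (L.cod (L.ent w (L.T z)) (L.T z) ++ w)) := by
    intro z hz hg c hc
    have hc' : L.cod (L.ent w (L.T z) + 1) z ++ w =
        c :: (L.cod (L.ent w (L.T z)) (L.T z) ++ w) := by
      simp [cod, letter_eq hc]
    rw [← hF, ← hc']
    by_cases h : L.Fol w z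
    · have hret := ret_ent h (hexT z hz hg)
      rw [ent_of_fol h, cod_append_eq h hret.2.2.1,
        hR _ (mem_rightReturn.2 ⟨z, hz, _, hret, rfl⟩)]
      rfl
    · rw [ent_of_not_fol h (hexT z hz hg)]
  obtain ⟨k, hk⟩ := exists_eq_comp_snd hnc hfin hne (fun z => F (L.cod (L.ent w z) z ++ w)) θ z₀.2
    hK hz₀.1 rfl (F w) (by
      filter_upwards [hw.eventually] with q hq _
      rw [ent_of_fol hq]
      rfl)
  have hkT : ∀ z ∈ L.Z, (z.2 = z₀.2 ∨ L.Nonorientable) → ∀ c, z ∈ L.Ia c →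
      k z.2 = θ c (k (L.T z).2) := by
    intro z hz hg c hc
    rw [← hk z hz hg, hK z hz hg c hc, hk (L.T z) (T_mem_Z hz)
      ((snd_eq_or_iff hz.1 ((mem_Z.1 hz).1.2 0)).2 hg)]
  refine ⟨k, ?_, fun c hg => ?_⟩
  · have hFu : ∀ u, F u = (u.map θ).prod (F []) := by
      intro u
      induction u with
      | nil => rfl
      | cons c u ih => simp [hF, ih]
    have hku : ∀ u z, z ∈ L.Z → (z.2 = z₀.2 ∨ L.Nonorientable) → L.Fol u z →
        k z.2 = (u.map θ).prod (k ((L.T)^[u.length] z).2) := by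
      intro u
      induction u with
      | nil => intro z _ _ _; rfl
      | cons c u ih =>
        intro z hz hg hu
        rw [hkT z hz hg c hu.1, ih _ (T_mem_Z hz)
          ((snd_eq_or_iff hz.1 ((mem_Z.1 hz).1.2 0)).2 hg) hu.2]
        simp
    have h1 := hk z₀ hz₀ (Or.inl rfl)
    rw [ent_of_fol hw, hku w z₀ hz₀ (Or.inl rfl) hw] at h1
    exact ((w.map θ).prod.injective ((hFu w).symm.trans h1)).symm
  · obtain ⟨q, hq⟩ := L.exists_point c
    obtain ⟨z, hz, hc⟩ := exists_mem_Z hfin (mem_Ihat_of_mem_Ia hq) ((L.isOpen_Ia c).mem_nhds hq)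
    have h2 := (mem_Ia.1 hc).2
    have := hkT z hz (by rwa [h2]) c hc
    rwa [h2, T_snd hc] at this

theorem path_of_mem_rightReturn [Nonempty A] {w u : List (Letter A)} (hw : w ≠ [])
    {z₀ : ℝ × Bool} (hz₀ : L.Fol w z₀) (hu : u ∈ RightReturn L.lang w) :
    L.Path ((L.T)^[w.length] z₀).2 u ((L.T)^[w.length] z₀).2 := by
  obtain ⟨z, hz, n, h, rfl⟩ := mem_rightReturn.1 hu
  have h1 : ∀ z', L.Fol w z' → ((L.T)^[w.length] z').2 = ((L.T)^[w.length] z₀).2 := by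
    intro z' h'
    have h2 := h'.path
    rw [h2.left_unique hw hz₀.path] at h2
    exact h2.right_unique hz₀.path
  have h2 := ((mem_Z.1 (iterate_mem_Z hz w.length)).1.reg n).fol_cod.path
  rw [length_cod, ← Function.iterate_add_apply, Nat.add_comm, Function.iterate_add_apply,
    h1 _ h.1, h1 _ h.2.2.1] at h2
  exact h2

/-- The return words generate the even group. -/
theorem range_lift_rightReturn [Nonempty A] (hnc : ¬ L.HasConnection) (hfin : L.Sig.Finite)
    (hne : L.Sig.Nonempty) {w : List (Letter A)} (hw : w ≠ []) {z₀ : ℝ × Bool} (hz₀ : z₀ ∈ L.Z)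
    (hwz : L.Fol w z₀) :
    (FreeGroup.lift (fun x : FreeGroup.mk '' RightReturn L.lang w => (x : FreeGroup A))).range =
      L.evenGroup := by
  set R := RightReturn L.lang w with hRdef
  set H := (FreeGroup.lift (fun x : FreeGroup.mk '' R => (x : FreeGroup A))).range with hH
  have hmem : ∀ u ∈ R, FreeGroup.mk u ∈ H := fun u hu =>
    ⟨FreeGroup.of ⟨_, mem_image_of_mem _ hu⟩, by simp⟩
  refine le_antisymm ?_ ?_
  · refine FreeGroup.range_lift_le ?_
    rintro _ ⟨⟨_, u, hu, rfl⟩, rfl⟩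
    rw [SetLike.mem_coe, evenGroup, MonoidHom.mem_ker,
      L.evenHom_of_path (path_of_mem_rightReturn hw hwz hu)]
    simp
  · obtain ⟨k, hk0, hk⟩ := exists_transport hnc hfin hne hz₀ hwz
      (F := fun u => ((FreeGroup.mk u : FreeGroup A) : FreeGroup A ⧸ H))
      (θ := fun c => MulAction.toPerm (FreeGroup.mk [c] : FreeGroup A))
      (by
        intro c u
        rw [mk_cons]
        rfl)
      (by
        intro u hu
        rw [← FreeGroup.mul_mk, QuotientGroup.mk_mul_of_mem _ (hmem u hu)])
    set e := ((L.T)^[w.length] z₀).2 with he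
    obtain ⟨k', hk'0, hk'⟩ : ∃ k' : Bool → FreeGroup A ⧸ H, k' e = ((1 : FreeGroup A) : _) ∧
        ∀ c ε, (FreeGroup.mk [c] : FreeGroup A) • k' ε =
          k' (if L.comp c = L.comp (Letter.inv c) then !ε else ε) := by
      have hinv : ∀ (c : Letter A) (x y : FreeGroup A ⧸ H),
          x = (FreeGroup.mk [Letter.inv c] : FreeGroup A) • y →
          (FreeGroup.mk [c] : FreeGroup A) • x = y := by
        rintro c x y rfl
        rw [mk_letter_inv, smul_inv_smul]
      simp only [MulAction.toPerm_apply] at hk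
      by_cases ho : L.Nonorientable
      · refine ⟨k, by rw [hk0, FreeGroup.one_eq_mk], fun c ε => ?_⟩
        have h1 := hk c (Or.inr ho)
        have h2 := hinv _ _ _ (hk (Letter.inv c) (Or.inr ho))
        rw [Letter.inv_inv] at h2
        cases hc : L.comp c <;> cases hc' : L.comp (Letter.inv c) <;> cases ε <;>
          (rw [hc, hc'] at h1 h2; first | exact h1.symm | exact h2)
      · have hee : e = z₀.2 := ((mem_Z.1 hz₀).1.reg _).snd_eq ho
        refine ⟨fun _ => k e, by rw [hk0, FreeGroup.one_eq_mk], fun c ε => ?_⟩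
        have hne' : L.comp c ≠ L.comp (Letter.inv c) := fun h => ho ⟨c, h⟩
        simp only
        rcases Bool.eq_or_eq_not (L.comp c) z₀.2 with hc | hc
        · have h1 := hk c (Or.inl hc)
          rw [← Bool.eq_not_of_ne hne', hc, ← hee] at h1
          exact h1.symm
        · have hc' : L.comp (Letter.inv c) = z₀.2 := by
            rw [Bool.eq_not_of_ne hne'.symm, hc, Bool.not_not]
          have h1 := hk (Letter.inv c) (Or.inl hc')
          rw [Letter.inv_inv, ← Bool.eq_not_of_ne hne'.symm, hc', ← hee] at h1
          exact hinv _ _ _ h1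
    have hword : ∀ u : List (Letter A), ∃ b : Bool,
        L.evenHom (FreeGroup.mk u) = Multiplicative.ofAdd (if b then (1 : ZMod 2) else 0) ∧
        ∀ ε, (FreeGroup.mk u : FreeGroup A) • k' ε = k' (xor b ε) := by
      intro u
      induction u with
      | nil => exact ⟨false, by simp [← FreeGroup.one_eq_mk], by simp [← FreeGroup.one_eq_mk]⟩
      | cons c u ih =>
        obtain ⟨b, hb, hb'⟩ := ih
        refine ⟨xor (decide (L.comp c = L.comp (Letter.inv c))) b, ?_, fun ε => ?_⟩
        · rw [mk_cons, map_mul, hb, evenHom_letter, ← ofAdd_add]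
          by_cases hc : L.comp c = L.comp (Letter.inv c) <;> cases b <;> simp [hc] <;> decide
        · rw [mk_cons, mul_smul, hb', hk']
          by_cases hc : L.comp c = L.comp (Letter.inv c) <;> cases b <;> simp [hc]
    intro g hg
    rw [evenGroup, MonoidHom.mem_ker] at hg
    obtain ⟨u, rfl⟩ := Quot.exists_rep g
    rw [FreeGroup.quot_mk_eq_mk] at hg ⊢
    obtain ⟨b, hb, hb'⟩ := hword u
    cases b with
    | true => rw [hg] at hb; exact absurd hb (by decide)
    | false =>
      have h1 := hb' e
      rw [Bool.false_xor, hk'0] at h1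
      have h2 : ((1 : FreeGroup A) : FreeGroup A ⧸ H) = ((FreeGroup.mk u : FreeGroup A) : FreeGroup A ⧸ H) := by
        rw [← h1]
        exact congrArg _ (mul_one _)
      simpa using QuotientGroup.eq.1 h2

end LinearInvolution

/-- A function which is locally constant along a dense set off a finite set `B` takes at most
`B.card + 1` values on an interval. -/
theorem encard_image_le_card_add_one {Y : Type*} {D : Set ℝ} {g : ℝ → Y} (B : Finset ℝ)
    (hB : ∀ x ∈ B, x ∉ D) {J : Set ℝ} (hJ : J.OrdConnected) (hJo : IsOpen J)
    (hd : ∀ x ∈ J, ∀ V ∈ 𝓝 x, ∃ x' ∈ D, x' ∈ V)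
    (hloc : ∀ x ∈ J, x ∉ B → ∃ y, ∀ᶠ x' in 𝓝 x, x' ∈ D → g x' = y) :
    (g '' (J ∩ D)).encard ≤ B.card + 1 := by
  induction B using Finset.induction_on_max generalizing J with
  | empty =>
    simp only [Finset.card_empty, Nat.cast_zero, zero_add, encard_le_one_iff]
    rintro _ _ ⟨x, ⟨h1, h2⟩, rfl⟩ ⟨y, ⟨h3, h4⟩, rfl⟩
    exact (eq_of_locally_const hJ.isPreconnected hJo hd (fun x hx => hloc x hx (by simp))
      h1 h2 h3 h4).symm
  | insert b s hb ih =>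
    have hbs : b ∉ s := fun h => lt_irrefl _ (hb b h)
    have h1 := ih (J := J ∩ Iio b) (fun x hx => hB x (Finset.mem_insert_of_mem hx))
      (hJ.inter ordConnected_Iio) (hJo.inter isOpen_Iio) (fun x hx => hd x hx.1)
      (fun x hx hxs => hloc x hx.1 (by simp [hxs, (mem_Iio.1 hx.2).ne]))
    have h2 : (g '' (J ∩ Ioi b ∩ D)).encard ≤ 1 := by
      rw [encard_le_one_iff]
      rintro _ _ ⟨x, ⟨h1, h2⟩, rfl⟩ ⟨y, ⟨h3, h4⟩, rfl⟩
      refine (eq_of_locally_const (hJ.inter ordConnected_Ioi).isPreconnected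
        (hJo.inter isOpen_Ioi) (fun x hx => hd x hx.1) (fun x hx => hloc x hx.1 ?_)
        h1 h2 h3 h4).symm
      have hx2 : b < x := hx.2
      rw [Finset.mem_insert, not_or]
      exact ⟨hx2.ne', fun h => lt_asymm hx2 (hb x h)⟩
    have h3 : g '' (J ∩ D) ⊆ g '' (J ∩ Iio b ∩ D) ∪ g '' (J ∩ Ioi b ∩ D) := by
      rw [← image_union]
      refine image_mono ?_
      rintro x ⟨hx, hxD⟩
      have : x ≠ b := by
        rintro rfl
        exact hB x (Finset.mem_insert_self _ _) hxD
      rcases this.lt_or_gt with h | h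
      · exact Or.inl ⟨⟨hx, h⟩, hxD⟩
      · exact Or.inr ⟨⟨hx, h⟩, hxD⟩
    calc (g '' (J ∩ D)).encard ≤ _ := encard_le_encard h3
      _ ≤ _ := encard_union_le _ _
      _ ≤ (s.card + 1) + 1 := add_le_add h1 h2
      _ = _ := by rw [Finset.card_insert_of_notMem hbs]; push_cast; rfl

namespace LinearInvolution

variable {A : Type*} [Fintype A] {L : LinearInvolution A}

/-- Two assignments of group elements to letters with the same values on return words differ by
a gauge transformation. -/
theorem exists_gauge [Nonempty A] (hnc : ¬ L.HasConnection) (hfin : L.Sig.Finite)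
    (hne : L.Sig.Nonempty) {w : List (Letter A)} {z₀ : ℝ × Bool} (hz₀ : z₀ ∈ L.Z)
    (hwz : L.Fol w z₀) {G : Type*} [Group G] (φ φ' : Letter A → G)
    (h : ∀ u ∈ RightReturn L.lang w, (u.map φ).prod = (u.map φ').prod) :
    ∃ γ : Bool → G, γ ((L.T)^[w.length] z₀).2 = 1 ∧
      ∀ c, (L.comp c = z₀.2 ∨ L.Nonorientable) →
        φ' c = γ (L.comp c) * φ c * (γ (!L.comp (Letter.inv c)))⁻¹ := by
  obtain ⟨k, hk0, hk⟩ := exists_transport hnc hfin hne hz₀ hwz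
    (F := fun u => (u.map φ').prod * ((u.map φ).prod)⁻¹)
    (θ := fun c => (Equiv.mulLeft (φ' c)).trans (Equiv.mulRight (φ c)⁻¹))
    (by intro c u; simp [mul_assoc])
    (by intro u hu; simp [h u hu])
  refine ⟨k, by simpa using hk0, fun c hc => ?_⟩
  rw [hk c hc]
  simp

theorem Reg.eventually_fol_iff {w : List (Letter A)} {z : ℝ × Bool} (h : L.Reg w.length z) :
    ∀ᶠ q in 𝓝 z, L.Fol w q ↔ L.Fol w z := by
  rcases isEmpty_or_nonempty A with hA | hA
  · cases w with
    | nil => exact Eventually.of_forall fun q => Iff.rfl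
    | cons c w => exact isEmptyElim c
  filter_upwards [h.eventually, h.eventually_cod_eq] with q h1 h2
  rw [h.fol_iff, h1.fol_iff, h2]

theorem Ret.eventually {w : List (Letter A)} {z : ℝ × Bool} {m : ℕ} (h : L.Ret w z m)
    (hr : L.Reg (m + w.length) z) : ∀ᶠ q in 𝓝 z, L.Ret w q m := by
  have h1 : ∀ i ≤ m, ∀ᶠ q in 𝓝 z, L.Fol w ((L.T)^[i] q) ↔ L.Fol w ((L.T)^[i] z) := by
    intro i hi
    have h2 : L.Reg (i + w.length) z := hr.mono (by omega)
    exact (hr.mono (by omega : i ≤ _)).continuousAt.eventually h2.iterate.eventually_fol_iff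
  have h2 : ∀ᶠ q in 𝓝 z, ∀ i ∈ Finset.range (m + 1),
      L.Fol w ((L.T)^[i] q) ↔ L.Fol w ((L.T)^[i] z) :=
    (Filter.eventually_all_finset _).2 fun i hi => h1 i (Nat.lt_succ_iff.1 (Finset.mem_range.1 hi))
  filter_upwards [h2] with q hq
  refine ⟨(hq 0 (by simp)).2 h.1, h.2.1, (hq m (by simp)).2 h.2.2.1, fun i h0 hi => ?_⟩
  rw [hq i (Finset.mem_range.2 (by omega))]
  exact h.2.2.2 i h0 hi

theorem Ret.ent_eq {w : List (Letter A)} {z : ℝ × Bool} {m : ℕ} (h : L.Ret w z m) :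
    L.ent w (L.T z) + 1 = m := by
  obtain ⟨j, rfl⟩ : ∃ j, m = j + 1 := ⟨m - 1, by have := h.2.1; omega⟩
  rw [LinearInvolution.ent_eq (n := j)]
  · exact h.2.2.1
  · intro i hi
    exact h.2.2.2 (i + 1) (Nat.succ_pos _) (by omega)

theorem exists_ret {w : List (Letter A)} {z : ℝ × Bool} (h : L.Fol w z) {n : ℕ} (hn : 0 < n)
    (h' : L.Fol w ((L.T)^[n] z)) : ∃ m ≤ n, L.Ret w z m := by
  classical
  have hex : ∃ m, 0 < m ∧ L.Fol w ((L.T)^[m] z) := ⟨n, hn, h'⟩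
  refine ⟨Nat.find hex, Nat.find_min' hex ⟨hn, h'⟩, h, (Nat.find_spec hex).1,
    (Nat.find_spec hex).2, fun i h0 hi hf => Nat.find_min hex hi ⟨h0, hf⟩⟩

theorem encard_rightReturn_le [Nonempty A] (hnc : ¬ L.HasConnection) (hfin : L.Sig.Finite)
    (hne : L.Sig.Nonempty) {w : List (Letter A)} (hw : w ≠ []) {z₀ : ℝ × Bool}
    (hwz : L.Fol w z₀) :
    (RightReturn L.lang w).encard ≤ {s ∈ L.Sig | s.2 = z₀.2 ∨ L.Nonorientable}.ncard + 1 := by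
  set δ := z₀.2 with hδ
  set S : Set (ℝ × Bool) := {s ∈ L.Sig | s.2 = δ ∨ L.Nonorientable} with hS
  have hSfin : S.Finite := hfin.subset fun s hs => hs.1
  set D : Set ℝ := {x | (x, δ) ∈ L.Z} with hD
  set J : Set ℝ := {x | L.Fol w (x, δ)} with hJ
  have hIhat : ∀ x ∈ J, (x, δ) ∈ L.Ihat := by
    intro x hx
    cases w with
    | nil => exact absurd rfl hw
    | cons c w => exact mem_Ihat_of_mem_Ia hx.1
  set B : Set ℝ := {x | x ∈ J ∧ ∃ n, L.Reg n (x, δ) ∧ (L.T)^[n] (x, δ) ∈ L.Sig ∧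
    ∀ i, 0 < i → i ≤ n → ¬ L.Fol w ((L.T)^[i] (x, δ))} with hB
  have hcont : Continuous fun x : ℝ => (x, δ) := by fun_prop
  have hBle : B.Finite ∧ B.ncard ≤ S.ncard := by
    choose! τ hτ using fun (x : ℝ) (hx : x ∈ B) => hx.2
    have hmaps : MapsTo (fun x => (L.T)^[τ x] (x, δ)) B S := by
      intro x hx
      refine ⟨(hτ x hx).2.1, ?_⟩
      by_cases ho : L.Nonorientable
      · exact Or.inr ho
      · exact Or.inl ((hτ x hx).1.snd_eq ho)
    have hle : ∀ x ∈ B, ∀ y ∈ B, (L.T)^[τ x] (x, δ) = (L.T)^[τ y] (y, δ) → τ x ≤ τ y →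
        x = y := by
      intro x hx y hy hxy hle
      obtain ⟨d, hd⟩ := Nat.exists_eq_add_of_le hle
      have h1 : L.Reg (d + τ x) (y, δ) := by rw [Nat.add_comm, ← hd]; exact (hτ y hy).1
      have h2 : (x, δ) = (L.T)^[d] (y, δ) := by
        refine (hτ x hx).1.inj h1.iterate ?_
        rw [hxy, hd, Function.iterate_add_apply]
      cases d with
      | zero => exact congrArg Prod.fst h2
      | succ d =>
        have h3 : L.Fol w (x, δ) := hx.1
        rw [h2] at h3
        exact absurd h3 ((hτ y hy).2.2 _ (Nat.succ_pos _) (by omega))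
    have hinj : InjOn (fun x => (L.T)^[τ x] (x, δ)) B := by
      intro x hx y hy hxy
      rcases le_total (τ x) (τ y) with h | h
      · exact hle x hx y hy hxy h
      · exact (hle y hy x hx hxy.symm h).symm
    exact ⟨Finite.of_injOn hmaps hinj hSfin, ncard_le_ncard_of_injOn _ hmaps hinj hSfin⟩
  set g : ℝ → List (Letter A) := fun x =>
    L.cod (L.ent w (L.T (x, δ)) + 1) ((L.T)^[w.length] (x, δ)) with hg
  have hsub : RightReturn L.lang w ⊆ g '' (J ∩ D) := by
    intro u hu
    obtain ⟨z, hz, n, h, rfl⟩ := mem_rightReturn.1 hu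
    have h2 : (z.1, δ) = z := by rw [hδ, hwz.path.left_unique hw h.1.path]
    refine ⟨z.1, ⟨?_, ?_⟩, ?_⟩
    · simpa only [hJ, mem_ofPred_eq, h2] using h.1
    · simpa only [hD, mem_ofPred_eq, h2] using hz
    · simp only [hg, h2, h.ent_eq]
  have hmain := encard_image_le_card_add_one (D := D) (g := g) (J := J) hBle.1.toFinset ?_ ?_ ?_ ?_
    ?_
  · refine (encard_le_encard hsub).trans (hmain.trans ?_)
    rw [← ncard_eq_toFinset_card _ hBle.1]
    gcongr
    exact hBle.2
  · intro x hx hxD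
    obtain ⟨-, n, -, h, -⟩ := hBle.1.mem_toFinset.1 hx
    exact (mem_Z.1 hxD).1.2 n h
  · exact ⟨fun x hx y hy z hz => Fol.ordConnected hz.1 hz.2 hx hy⟩
  · rw [isOpen_iff_mem_nhds]
    exact fun x hx => hcont.continuousAt.eventually (Fol.eventually hx)
  · intro x hx V hV
    have h1 : V ×ˢ ({δ} : Set Bool) ∈ 𝓝 (x, δ) :=
      prod_mem_nhds hV (by simp)
    obtain ⟨⟨y, ε⟩, hy, hyV, hε⟩ := exists_mem_Z hfin (hIhat x hx) h1
    obtain rfl : ε = δ := hε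
    exact ⟨y, hy, hyV⟩
  · intro x hx hxB
    rw [hBle.1.mem_toFinset] at hxB
    have hxJ : L.Fol w (x, δ) := hx
    obtain ⟨m, hm, hr⟩ : ∃ m, L.Ret w (x, δ) m ∧ L.Reg m (x, δ) := by
      by_cases hF : L.FwdInf (x, δ)
      · obtain ⟨n, hn⟩ := exists_fol hnc hfin hne hF.1 hxJ (hF.iterate 1)
          ((snd_eq_or_iff hF.1 (hF.2 0)).2 (Or.inl rfl))
        obtain ⟨m, -, hm⟩ := exists_ret hxJ (Nat.succ_pos n) hn
        exact ⟨m, hm, hF.reg m⟩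
      · obtain ⟨n, hn, hn'⟩ := exists_first_Sig (hIhat x hx) hF
        have : ∃ i, 0 < i ∧ i ≤ n ∧ L.Fol w ((L.T)^[i] (x, δ)) := by
          by_contra hcon
          push Not at hcon
          exact hxB ⟨hx, n, hn, hn', hcon⟩
        obtain ⟨i, h0, hi, hf⟩ := this
        obtain ⟨m, hmi, hm⟩ := exists_ret hxJ h0 hf
        exact ⟨m, hm, hn.mono (hmi.trans hi)⟩
    have hr' : L.Reg (m + w.length) (x, δ) :=
      hr.add (hm.2.2.1.reg (hr.mem_Ihat le_rfl))
    refine ⟨L.cod m ((L.T)^[w.length] (x, δ)), ?_⟩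
    have hcod : ∀ᶠ q in 𝓝 (x, δ), L.cod (m + w.length) q = L.cod (m + w.length) (x, δ) :=
      hr'.eventually_cod_eq
    filter_upwards [hcont.continuousAt.eventually (hm.eventually hr'),
      hcont.continuousAt.eventually hcod] with y h1 h2 _
    rw [Nat.add_comm, cod_add, cod_add] at h2
    simp only [hg, h1.ent_eq]
    exact (List.append_inj h2 (by simp)).2

theorem card_comp_le (hfin : L.Sig.Finite) (ε : Bool) :
    Nat.card {c : Letter A // L.comp c = ε} ≤ {s ∈ L.Sig | s.2 = ε}.ncard + 1 := by
  have hSfin : {s ∈ L.Sig | s.2 = ε}.Finite := hfin.subset fun s hs => hs.1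
  have h1 : MapsTo (fun c => (L.endHi c, ε)) {c : Letter A | L.comp c = ε}
      (insert (L.hi, ε) {s ∈ L.Sig | s.2 = ε}) := by
    intro c hc
    have hc' : L.comp c = ε := hc
    rcases (L.sub_hi c).eq_or_lt with h | h
    · left
      simp only [h]
    · right
      have := right_end_mem_Sig h
      rw [hc'] at this
      exact ⟨this, rfl⟩
  have h2 : InjOn (fun c => (L.endHi c, ε)) {c : Letter A | L.comp c = ε} := by
    intro c hc d hd hcd
    have hcd' : L.endHi c = L.endHi d := congrArg Prod.fst hcd
    obtain ⟨x, hx, hx'⟩ := exists_between (max_lt (L.end_lt c) (hcd' ▸ L.end_lt d))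
    rw [max_lt_iff] at hx
    exact eq_of_mem_Ia (z := (x, ε)) (mem_Ia.2 ⟨⟨hx.1, hx'⟩, hc.symm⟩)
      (mem_Ia.2 ⟨⟨hx.2, hcd' ▸ hx'⟩, hd.symm⟩)
  exact (ncard_le_ncard_of_injOn _ h1 h2 (hSfin.insert _)).trans (ncard_insert_le _ _)

end LinearInvolution

theorem isBasisOf_singleton_letter {A : Type*} [Subsingleton A] (c : Letter A) :
    IsBasisOf ({FreeGroup.mk [c]} : Set (FreeGroup A)) ⊤ := by
  set X : Set (FreeGroup A) := {FreeGroup.mk [c]} with hX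
  set x : X := ⟨FreeGroup.mk [c], rfl⟩ with hx
  have hx' : ∀ y : X, y = x := fun y => Subtype.ext y.2
  set ℓ : FreeGroup X →* FreeGroup A := FreeGroup.lift fun x : X => (x : FreeGroup A) with hℓ
  have hc : (FreeGroup.mk [c] : FreeGroup A) =
      if c.2 then FreeGroup.of c.1 else (FreeGroup.of c.1)⁻¹ := by
    obtain ⟨a, b⟩ := c
    cases b <;> rfl
  refine ⟨?_, ?_⟩
  · set ψ : FreeGroup A →* FreeGroup X := FreeGroup.lift fun _ =>
      if c.2 then FreeGroup.of x else (FreeGroup.of x)⁻¹ with hψ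
    have h : ψ.comp ℓ = MonoidHom.id _ := by
      refine FreeGroup.ext_hom _ _ fun y => ?_
      obtain rfl := hx' y
      have h1 : ℓ (FreeGroup.of x) = FreeGroup.mk [c] := FreeGroup.lift_apply_of
      rw [MonoidHom.comp_apply, h1, hc, MonoidHom.id_apply]
      cases h2 : c.2 <;> simp [hψ, h2]
    exact Function.LeftInverse.injective (g := ψ) fun y => DFunLike.congr_fun h y
  · rw [eq_top_iff, ← FreeGroup.closure_range_of A, Subgroup.closure_le]
    rintro _ ⟨a, rfl⟩
    have h1 : FreeGroup.mk [c] ∈ ℓ.range := ⟨FreeGroup.of x, FreeGroup.lift_apply_of⟩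
    rw [hc, Subsingleton.elim c.1 a] at h1
    cases h2 : c.2
    · simpa [h2] using h1
    · simpa [h2] using h1

namespace LinearInvolution

variable {A : Type*} [Fintype A] {L : LinearInvolution A}

theorem T_mem_Ia_of_subsingleton [Subsingleton A] {z : ℝ × Bool} (hz : z ∈ L.Z)
    {c : Letter A} (hc : z ∈ L.Ia c) : L.T z ∈ L.Ia c ∧ L.comp c ≠ L.comp (Letter.inv c) := by
  have h1 := T_mem_Z hz
  obtain ⟨d, hd⟩ := exists_mem_Ia h1.1 ((mem_Z.1 h1).1.2 0)
  have h2 := (mem_Ia.1 (s2_T_mem_Ia hc)).2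
  have h3 := (mem_Ia.1 hd).2
  have hd' : d = c ∨ d = Letter.inv c := by
    obtain ⟨a, b⟩ := c
    obtain ⟨a', b'⟩ := d
    obtain rfl := Subsingleton.elim a a'
    cases b <;> cases b' <;> simp [Letter.inv]
  simp only [s2] at h2
  rcases hd' with rfl | rfl
  · refine ⟨hd, ?_⟩
    rw [← h2, ← h3]
    simp
  · rw [h3] at h2
    simp at h2

theorem fol_iff_of_subsingleton [Subsingleton A] {c : Letter A} {u : List (Letter A)} :
    ∀ {z : ℝ × Bool}, z ∈ L.Z → z ∈ L.Ia c → (L.Fol u z ↔ ∀ d ∈ u, d = c) := by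
  induction u with
  | nil => intro z _ _; simp [Fol]
  | cons d u ih =>
    intro z hz hc
    rw [Fol, ih (T_mem_Z hz) (T_mem_Ia_of_subsingleton hz hc).1, List.forall_mem_cons]
    exact and_congr_left fun _ => ⟨fun hd => eq_of_mem_Ia hd hc, fun h => h ▸ hc⟩

theorem iterate_mem_Ia_of_subsingleton [Subsingleton A] {z : ℝ × Bool} (hz : z ∈ L.Z)
    {c : Letter A} (hc : z ∈ L.Ia c) (n : ℕ) : (L.T)^[n] z ∈ L.Ia c := by
  induction n with
  | zero => exact hc
  | succ n ih =>
    rw [Function.iterate_succ_apply']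
    exact (T_mem_Ia_of_subsingleton (iterate_mem_Z hz n) ih).1

theorem rightReturn_of_subsingleton [Subsingleton A] {w : List (Letter A)} (hw : w ≠ [])
    {z₀ : ℝ × Bool} (hz₀ : z₀ ∈ L.Z) {c : Letter A} (hc : z₀ ∈ L.Ia c) (hwz : L.Fol w z₀) :
    RightReturn L.lang w = {[c]} := by
  have : Nonempty A := ⟨c.1⟩
  have hwc := (fol_iff_of_subsingleton hz₀ hc).1 hwz
  have hret : ∀ z ∈ L.Z, z ∈ L.Ia c → L.Ret w z 1 := by
    refine fun z hz hzc => ⟨(fol_iff_of_subsingleton hz hzc).2 hwc, one_pos,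
      (fol_iff_of_subsingleton (T_mem_Z hz) (T_mem_Ia_of_subsingleton hz hzc).1).2 hwc,
      fun i h0 h1 => by omega⟩
  have hcod : ∀ z ∈ L.Z, z ∈ L.Ia c → L.cod 1 ((L.T)^[w.length] z) = [c] := by
    intro z hz hzc
    simp [cod, letter_eq (iterate_mem_Ia_of_subsingleton hz hzc w.length)]
  ext u
  rw [mem_rightReturn, mem_singleton_iff]
  constructor
  · rintro ⟨z, hz, n, h, rfl⟩
    have hzc : z ∈ L.Ia c := by
      cases w with
      | nil => exact absurd rfl hw
      | cons d w => exact hwc d (by simp) ▸ h.1.1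
    rw [← h.ent_eq, (hret z hz hzc).ent_eq, hcod z hz hzc]
  · rintro rfl
    exact ⟨z₀, hz₀, 1, hret z₀ hz₀ hc, (hcod z₀ hz₀ hc).symm⟩

theorem evenGroup_eq_top [Subsingleton A] {c : Letter A}
    (h : L.comp c ≠ L.comp (Letter.inv c)) : L.evenGroup = ⊤ := by
  have h1 : L.evenHom = 1 := by
    refine FreeGroup.ext_hom _ _ fun a => ?_
    have : L.comp (a, true) ≠ L.comp (a, false) := by
      obtain ⟨a', b⟩ := c
      obtain rfl := Subsingleton.elim a a'
      cases b
      · exact h.symm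
      · exact h
    simp [evenHom, this]
  rw [evenGroup, h1, MonoidHom.ker_one]

theorem ncard_rightReturn_le (hnc : ¬ L.HasConnection) (hfin : L.Sig.Finite)
    (hne : L.Sig.Nonempty) {w : List (Letter A)} (hw : w ≠ []) {z₀ : ℝ × Bool}
    (hwz : L.Fol w z₀) :
    (RightReturn L.lang w).Finite ∧
      (L.Nonorientable → (RightReturn L.lang w).ncard + 1 ≤ Fintype.card (Letter A)) ∧
      (¬ L.Nonorientable →
        (RightReturn L.lang w).ncard ≤ Nat.card {c : Letter A // L.comp c = z₀.2}) := by
  obtain ⟨c, -⟩ := List.exists_mem_of_ne_nil w hw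
  have : Nonempty A := ⟨c.1⟩
  have h := encard_rightReturn_le hnc hfin hne hw hwz
  have hRfin : (RightReturn L.lang w).Finite :=
    finite_of_encard_le_coe (k := {s ∈ L.Sig | s.2 = z₀.2 ∨ L.Nonorientable}.ncard + 1)
      (by exact_mod_cast h)
  have hR : (RightReturn L.lang w).ncard ≤
      {s ∈ L.Sig | s.2 = z₀.2 ∨ L.Nonorientable}.ncard + 1 := by
    rw [← hRfin.cast_ncard_eq] at h
    exact_mod_cast h
  have hcard : Fintype.card (Letter A) = 2 * Fintype.card A := by
    rw [Fintype.card_prod, Fintype.card_bool, Nat.mul_comm]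
  have hS := L.Sig_card
  have hpos := Fintype.card_pos (α := A)
  refine ⟨hRfin, fun ho => ?_, fun ho => ?_⟩
  · simp only [ho, or_true, and_true, ofPred_mem_eq] at hR
    have : 0 < L.Sig.ncard := (ncard_pos hfin).2 hne
    omega
  · simp only [ho, or_false] at hR
    have h1 := card_comp_le hfin (!z₀.2)
    have h2 : {s ∈ L.Sig | s.2 = z₀.2}.ncard + {s ∈ L.Sig | s.2 = !z₀.2}.ncard = L.Sig.ncard := by
      rw [← ncard_union_eq _ (hfin.subset fun s hs => hs.1) (hfin.subset fun s hs => hs.1)]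
      · congr 1
        ext s
        cases h : s.2 <;> cases z₀.2 <;> simp [h]
      · rw [disjoint_left]
        rintro s ⟨-, hs⟩ ⟨-, hs'⟩
        rw [hs] at hs'
        simp at hs'
    have h3 : Nat.card {c : Letter A // L.comp c = z₀.2} +
        Nat.card {c : Letter A // L.comp c = !z₀.2} = Fintype.card (Letter A) := by
      rw [← Nat.card_eq_fintype_card, ← Nat.card_congr (Equiv.sumCompl fun c => L.comp c = z₀.2),
        Nat.card_sum]
      congr 1
      exact Nat.card_congr (Equiv.subtypeEquivRight fun c => by rw [Bool.eq_not])
    have : 0 < L.Sig.ncard := (ncard_pos hfin).2 hne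
    omega

end LinearInvolution

end

/-- the set of first right return words to `w` is a basis of the
even group of `T`. -/
theorem stmt_11 {A : Type*} [Fintype A] (L : LinearInvolution A)
    (hnc : ¬ L.HasConnection) (w : List (Letter A)) (hw : w ∈ L.lang)
    (hne : w ≠ []) :
    IsBasisOf (FreeGroup.mk '' RightReturn L.lang w) L.evenGroup := by
  obtain ⟨c, -⟩ := List.exists_mem_of_ne_nil w hne
  have : Nonempty A := ⟨c.1⟩
  obtain ⟨z₀, hz₀, hwz⟩ := LinearInvolution.mem_lang.1 hw
  by_cases hA : Subsingleton A
  · obtain ⟨d, hd⟩ := LinearInvolution.exists_mem_Ia hz₀.1 ((LinearInvolution.mem_Z.1 hz₀).1.2 0)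
    rw [LinearInvolution.rightReturn_of_subsingleton hne hz₀ hd hwz, image_singleton,
      LinearInvolution.evenGroup_eq_top (LinearInvolution.T_mem_Ia_of_subsingleton hz₀ hd).2]
    exact isBasisOf_singleton_letter d
  · have hpos : 0 < L.Sig.ncard := by
      have : 1 < Fintype.card A := by
        rwa [← Fintype.card_le_one_iff_subsingleton, not_le] at hA
      rw [L.Sig_card]
      omega
    have hS := nonempty_of_ncard_ne_zero hpos.ne'
    have hfin := finite_of_ncard_pos hpos
    obtain ⟨h1, h2, h3⟩ := LinearInvolution.ncard_rightReturn_le hnc hfin hS hne hwz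
    refine ⟨?_, LinearInvolution.range_lift_rightReturn hnc hfin hS hne hz₀ hwz⟩
    refine L.lift_injective_of_solvable _ _
      (fun u => LinearInvolution.path_of_mem_rightReturn hne hwz) fun G _ _ f => ?_
    refine L.exists_solution _ h1 z₀.2 ((L.T)^[w.length] z₀).2 ?_ h2 h3
      (fun φ φ' => LinearInvolution.exists_gauge hnc hfin hS hz₀ hwz φ φ') f
    by_cases ho : L.Nonorientable
    · exact Or.inl ho
    · exact Or.inr (((LinearInvolution.mem_Z.1 hz₀).1.reg _).snd_eq ho)

end LinInv
end

section
/- Let T be a linear involution without connection and let S = L(T) be its natural coding. For every nonempty word x ∈ S, every first right return word to x in S is an even word. -/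
open Set

namespace LinInv

namespace LinearInvolution

variable {A : Type*} [Fintype A] (L : LinearInvolution A)

theorem snd_T_of_mem_Ia {c : Letter A} {z : ℝ × Bool} (hz : z ∈ L.Ia c) :
    (L.T z).2 = !L.comp (Letter.inv c) := by
  have h : L.s1 z ∈ L.s1 '' L.Ia c := mem_image_of_mem _ hz
  have h' : (L.s1 z).2 = L.comp (Letter.inv c) := by
    unfold Ia at h
    rw [L.s1_image c] at h
    exact h.2
  simp [T, s2, h']

variable {L} in
theorem IsCodingFrom.head {z : ℝ × Bool} {m : ℕ} {c : Letter A} {u : List (Letter A)}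
    (h : L.IsCodingFrom z m (c :: u)) : (L.T)^[m] z ∈ L.Ia c := by
  simpa using h ⟨0, by simp⟩

variable {L} in
theorem IsCodingFrom.tail {z : ℝ × Bool} {m : ℕ} {c : Letter A} {u : List (Letter A)}
    (h : L.IsCodingFrom z m (c :: u)) : L.IsCodingFrom z (m + 1) u := by
  intro i
  have := h ⟨i.1 + 1, by simp⟩
  simpa [add_assoc, add_comm 1] using this

/-- Along an orbit, the component is preserved exactly by the even words. -/
theorem evenWord_iff_of_isCodingFrom {z : ℝ × Bool} {c : Letter A} {t p : List (Letter A)}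
    {m : ℕ} (h : L.IsCodingFrom z m (p ++ c :: t)) :
    L.EvenWord p ↔ ((L.T)^[m] z).2 = L.comp c := by
  induction p generalizing m with
  | nil =>
    have := h.head.2
    simpa [EvenWord] using this
  | cons d p ih =>
    have h1 := h.head
    have h2 := L.snd_T_of_mem_Ia h1
    have h3 : ((L.T)^[m] z).2 = L.comp d := h1.2
    have ih := ih h.tail
    rw [Function.iterate_succ_apply', h2] at ih
    rw [h3]
    obtain ⟨a, b⟩ := d
    unfold EvenWord at ih ⊢
    rw [List.countP_cons]
    cases b <;> simp only [Letter.inv, Bool.not_true, Bool.not_false] at ih ⊢ <;>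
      cases h4 : L.comp (a, true) <;> cases h5 : L.comp (a, false) <;>
      cases h6 : L.comp c <;> simp_all [Nat.even_add_one]

end LinearInvolution

/-- every first right return word to a nonempty `x ∈ L(T)` is an
even word. -/
theorem stmt_12 {A : Type*} [Fintype A] (L : LinearInvolution A)
    (hnc : ¬ L.HasConnection) (x : List (Letter A)) (hx : x ∈ L.lang)
    (hne : x ≠ []) :
    ∀ u ∈ RightReturn L.lang x, L.EvenWord u := by
  rintro u ⟨⟨⟨z, -, m, hz⟩, -, s, hs, hsuf, -⟩, -⟩
  obtain rfl : s = x := hs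
  obtain ⟨p, hp⟩ := hsuf
  have hcount : L.EvenWord u ↔ L.EvenWord p := by
    unfold LinearInvolution.EvenWord
    have := congrArg
      (List.countP fun c : Letter A => L.comp (c.1, true) == L.comp (c.1, false)) hp
    rw [List.countP_append, List.countP_append, add_comm] at this
    rw [Nat.add_left_cancel this]
  obtain ⟨c, t, rfl⟩ := List.exists_cons_of_ne_nil hne
  rw [hcount, L.evenWord_iff_of_isCodingFrom (hp ▸ hz)]
  exact (LinearInvolution.IsCodingFrom.head hz).2

end LinInv
end
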